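/- Let S be a finite planar point set in general position, v1 ∈ S, and let S' be the set of points p ∈ S \ {v1} such that v1p is a viable starting edge (some plane spanning path of S starts with v1p). Then for any two points q, r ∈ S' that are consecutive in the radial (circular) order around v1 restricted to S', there exists a plane straight-line spanning cycle on S containing both edges v1q and v1r. -/

import Mathlib

open scoped Classical

noncomputable section

abbrev Pt : Type := ℝ × ℝ

/-- default point -/
def pd : Pt := (0, 0)

/-- No three distinct points of `S` are collinear. -/
def GenPos (S : Finset Pt) : Prop :=
  ∀ p ∈ S, ∀ q ∈ S, ∀ r ∈ S, p ≠ q → p ≠ r → q ≠ r →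
    ¬ Collinear ℝ ({p, q, r} : Set Pt)

/-- The (ordered) edges of a path given as a list of vertices. -/
def pathEdges (l : List Pt) : List (Pt × Pt) := l.zip l.tail

/-- The (ordered) edges of a cycle given as a list of vertices. -/
def cycleEdges (l : List Pt) : List (Pt × Pt) := l.zip (l.rotate 1)

/-- A family of straight-line segments is pairwise non-crossing:
the open segments of any two distinct members are disjoint. -/
def NonCrossing (E : List (Pt × Pt)) : Prop :=
  E.Pairwise fun e f => openSegment ℝ e.1 e.2 ∩ openSegment ℝ f.1 f.2 = ∅

/-- `l` is a plane (crossing-free) straight-line spanning path of `S`. -/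
def IsPlanePath (S : Finset Pt) (l : List Pt) : Prop :=
  l.Nodup ∧ l.toFinset = S ∧ NonCrossing (pathEdges l)

/-- `l` is a plane straight-line spanning cycle of `S`. -/
def IsPlaneCycle (S : Finset Pt) (l : List Pt) : Prop :=
  3 ≤ l.length ∧ l.Nodup ∧ l.toFinset = S ∧ NonCrossing (cycleEdges l)

/-- The set of edges of a path, as unordered pairs. -/
def edgeSet (l : List Pt) : Finset (Sym2 Pt) :=
  ((pathEdges l).map fun e => s(e.1, e.2)).toFinset

/-- The set of edges of a cycle, as unordered pairs. -/
def cycleEdgeSet (l : List Pt) : Finset (Sym2 Pt) :=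
  ((cycleEdges l).map fun e => s(e.1, e.2)).toFinset

/-- No segment joining two points of `S` crosses any edge of the cycle `l`. -/
def UncrossedCycle (S : Finset Pt) (l : List Pt) : Prop :=
  ∀ a ∈ S, ∀ b ∈ S, a ≠ b → ∀ e ∈ cycleEdges l, s(a, b) ≠ s(e.1, e.2) →
    openSegment ℝ a b ∩ openSegment ℝ e.1 e.2 = ∅

/-- Two plane spanning paths of `S` differ by a single flip. -/
def FlipAdj (S : Finset Pt) (P Q : List Pt) : Prop :=
  IsPlanePath S P ∧ IsPlanePath S Q ∧
    ∃ e f, e ≠ f ∧ e ∈ edgeSet P ∧ f ∈ edgeSet Q ∧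
      (edgeSet P).erase e = (edgeSet Q).erase f

/-- There is a sequence of `k` flips from `P` to (a representative of) `Q`, all of whose
members are plane spanning paths of `S` satisfying the additional property `A`. -/
def FlipSeq (S : Finset Pt) (A : List Pt → Prop) (k : ℕ) (P Q : List Pt) : Prop :=
  ∃ f : ℕ → List Pt, f 0 = P ∧ edgeSet (f k) = edgeSet Q ∧
    (∀ i ≤ k, IsPlanePath S (f i) ∧ A (f i)) ∧
    ∀ i < k, FlipAdj S (f i) (f (i + 1))

/-- The flip graph on the plane spanning paths of `S` satisfying `A` is connected. -/
def FlipConnected (S : Finset Pt) (A : List Pt → Prop) : Prop :=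
  ∀ P Q : List Pt, IsPlanePath S P → A P → IsPlanePath S Q → A Q →
    ∃ k, FlipSeq S A k P Q

/-- `uv` is an edge of the boundary of the convex hull of `S`. -/
def HullEdge (S : Finset Pt) (u v : Pt) : Prop :=
  u ∈ S ∧ v ∈ S ∧ u ≠ v ∧ segment ℝ u v ⊆ frontier (convexHull ℝ (S : Set Pt))

/-- `p` is an extreme point (a vertex of the convex hull) of `S`. -/
def ExtremePt (S : Finset Pt) (p : Pt) : Prop :=
  p ∈ S ∧ p ∉ convexHull ℝ ((S.erase p : Finset Pt) : Set Pt)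

/-- `p` is a point of `S` lying strictly in the interior of the convex hull of `S`. -/
def InteriorPt (S : Finset Pt) (p : Pt) : Prop :=
  p ∈ S ∧ p ∈ interior (convexHull ℝ (S : Set Pt))

/-- Twice the signed area of the triangle `a b c` (orientation test). -/
def sign3 (a b c : Pt) : ℝ :=
  (b.1 - a.1) * (c.2 - a.2) - (b.2 - a.2) * (c.1 - a.1)

/-- View a planar point as a complex number. -/
def toC (a : Pt) : ℂ := ⟨a.1, a.2⟩

/-- The counterclockwise angle of `x` around `p`, measured from the
direction of `h`, normalized to lie in `[0, 2π)`. -/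
def angFrom (p h x : Pt) : ℝ :=
  if Complex.arg ((toC x - toC p) / (toC h - toC p)) < 0 then
    Complex.arg ((toC x - toC p) / (toC h - toC p)) + 2 * Real.pi
  else
    Complex.arg ((toC x - toC p) / (toC h - toC p))

/-- `uv` is a viable starting edge: some plane spanning path of `S` starts with `u, v`. -/
def Viable (S : Finset Pt) (u v : Pt) : Prop :=
  ∃ rest, IsPlanePath S (u :: v :: rest)

/-! ### Orientation -/

lemma sign3_rotate (a b c : Pt) : sign3 b c a = sign3 a b c := by
  unfold sign3; ring

lemma sign3_swap (a b c : Pt) : sign3 a c b = -sign3 a b c := by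
  unfold sign3; ring

@[simp] lemma sign3_self_left (a b : Pt) : sign3 a b a = 0 := by
  unfold sign3; ring

@[simp] lemma sign3_self_right (a b : Pt) : sign3 a b b = 0 := by
  unfold sign3; ring

lemma exists_sign3_of_mem_openSegment {x y z : Pt} (hz : z ∈ openSegment ℝ x y) :
    ∃ s t : ℝ, 0 < s ∧ 0 < t ∧ s + t = 1 ∧
      ∀ u v, sign3 u v z = s * sign3 u v x + t * sign3 u v y := by
  obtain ⟨s, t, hs, ht, hst, rfl⟩ := hz
  refine ⟨s, t, hs, ht, hst, fun u v => ?_⟩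
  obtain rfl : s = 1 - t := by linarith
  simp only [sign3, Prod.fst_add, Prod.snd_add, Prod.smul_fst, Prod.smul_snd, smul_eq_mul]
  ring

lemma sign3_pos_of_mem_openSegment {u v x y z : Pt} (hz : z ∈ openSegment ℝ x y)
    (hx : 0 ≤ sign3 u v x) (hy : 0 ≤ sign3 u v y) (h : 0 < sign3 u v x ∨ 0 < sign3 u v y) :
    0 < sign3 u v z := by
  obtain ⟨s, t, hs, ht, -, hst⟩ := exists_sign3_of_mem_openSegment hz
  rw [hst]
  rcases h with h | h
  · have := mul_pos hs h; have := mul_nonneg ht.le hy; linarith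
  · have := mul_pos ht h; have := mul_nonneg hs.le hx; linarith

lemma sign3_nonpos_of_mem_openSegment {u v x y z : Pt} (hz : z ∈ openSegment ℝ x y)
    (hx : sign3 u v x ≤ 0) (hy : sign3 u v y ≤ 0) : sign3 u v z ≤ 0 := by
  obtain ⟨s, t, hs, ht, -, hst⟩ := exists_sign3_of_mem_openSegment hz
  rw [hst]
  have := mul_nonneg hs.le (neg_nonneg.2 hx)
  have := mul_nonneg ht.le (neg_nonneg.2 hy)
  linarith

lemma sign3_ne_zero {S : Finset Pt} (hS : GenPos S) {p q r : Pt} (hp : p ∈ S) (hq : q ∈ S)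
    (hr : r ∈ S) (hpq : p ≠ q) (hpr : p ≠ r) (hqr : q ≠ r) : sign3 p q r ≠ 0 := by
  intro h
  refine hS p hp q hq r hr hpq hpr hqr ?_
  rw [collinear_iff_of_mem (p₀ := p) (by simp)]
  refine ⟨q - p, ?_⟩
  simp only [Set.mem_insert_iff, Set.mem_singleton_iff, forall_eq_or_imp, forall_eq, vadd_eq_add]
  refine ⟨⟨0, by simp⟩, ⟨1, by simp⟩, ?_⟩
  unfold sign3 at h
  by_cases h1 : q.1 - p.1 = 0
  · have h2 : q.2 - p.2 ≠ 0 := fun h2 => hpq (Prod.ext (by linarith) (by linarith))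
    rw [h1, zero_mul, zero_sub, neg_eq_zero, mul_eq_zero, or_iff_right h2] at h
    refine ⟨(r.2 - p.2) / (q.2 - p.2), Prod.ext ?_ ?_⟩
    · simp [h1]; linarith
    · simp; field_simp; ring
  · refine ⟨(r.1 - p.1) / (q.1 - p.1), Prod.ext ?_ ?_⟩
    · simp; field_simp; ring
    · simp; field_simp; linarith

/-- The open segments spanned by two edges are disjoint. -/
def SegDisj (e f : Pt × Pt) : Prop := openSegment ℝ e.1 e.2 ∩ openSegment ℝ f.1 f.2 = ∅

lemma segDisj_iff {e f : Pt × Pt} :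
    SegDisj e f ↔ ∀ z ∈ openSegment ℝ e.1 e.2, z ∉ openSegment ℝ f.1 f.2 := by
  simp [SegDisj, Set.eq_empty_iff_forall_notMem]

lemma SegDisj.symm {e f : Pt × Pt} (h : SegDisj e f) : SegDisj f e := by
  rwa [SegDisj, Set.inter_comm]

lemma SegDisj.swap_left {x y : Pt} {f : Pt × Pt} (h : SegDisj (x, y) f) : SegDisj (y, x) f := by
  rwa [SegDisj, openSegment_symm]

lemma SegDisj.swap_right {x y : Pt} {e : Pt × Pt} (h : SegDisj e (x, y)) : SegDisj e (y, x) :=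
  h.symm.swap_left.symm

lemma segDisj_of_nonpos_of_pos (u v : Pt) {e f : Pt × Pt}
    (he : sign3 u v e.1 ≤ 0) (he' : sign3 u v e.2 ≤ 0)
    (hf : 0 ≤ sign3 u v f.1) (hf' : 0 ≤ sign3 u v f.2)
    (h : 0 < sign3 u v f.1 ∨ 0 < sign3 u v f.2) : SegDisj e f :=
  segDisj_iff.2 fun _ hz hz' =>
    (sign3_pos_of_mem_openSegment hz' hf hf' h).not_ge (sign3_nonpos_of_mem_openSegment hz he he')

/-! ### Angles -/

lemma angFrom_nonneg (c h x : Pt) : 0 ≤ angFrom c h x := by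
  unfold angFrom
  have := Complex.neg_pi_lt_arg ((toC x - toC c) / (toC h - toC c))
  split_ifs <;> linarith [Real.pi_pos]

lemma angFrom_lt (c h x : Pt) : angFrom c h x < 2 * Real.pi := by
  unfold angFrom
  have := Complex.arg_le_pi ((toC x - toC c) / (toC h - toC c))
  split_ifs <;> linarith [Real.pi_pos]

lemma toC_sub_ne_zero {x c : Pt} (h : x ≠ c) : toC x - toC c ≠ 0 := by
  intro h0
  rw [sub_eq_zero, toC, toC, Complex.mk.injEq] at h0
  exact h (Prod.ext h0.1 h0.2)

lemma exists_polar {c h x : Pt} (hh : h ≠ c) (hx : x ≠ c) : ∃ ρ : ℝ, 0 < ρ ∧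
    toC x - toC c = ρ * Complex.exp (angFrom c h x * Complex.I) * (toC h - toC c) := by
  have hh' := toC_sub_ne_zero hh
  set w := (toC x - toC c) / (toC h - toC c) with hw
  have hw0 : w ≠ 0 := div_ne_zero (toC_sub_ne_zero hx) hh'
  refine ⟨‖w‖, norm_pos_iff.2 hw0, ?_⟩
  have key : Complex.exp (angFrom c h x * Complex.I) = Complex.exp (w.arg * Complex.I) := by
    unfold angFrom
    rw [← hw]
    split_ifs
    · push_cast
      rw [add_mul, Complex.exp_periodic]
    · rfl
  rw [key, Complex.norm_mul_exp_arg_mul_I, hw, div_mul_cancel₀ _ hh']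

lemma angFrom_eq_of_polar {c h x : Pt} {ρ θ : ℝ} (hh : h ≠ c) (hρ : 0 < ρ) (h0 : 0 ≤ θ)
    (h1 : θ < 2 * Real.pi)
    (hx : toC x - toC c = ρ * Complex.exp (θ * Complex.I) * (toC h - toC c)) :
    angFrom c h x = θ := by
  have hw : (toC x - toC c) / (toC h - toC c) = ρ * Complex.exp (θ * Complex.I) := by
    rw [hx, mul_div_cancel_right₀ _ (toC_sub_ne_zero hh)]
  unfold angFrom
  rw [hw]
  rcases le_or_gt θ Real.pi with hθ | hθ
  · rw [Complex.exp_mul_I, Complex.arg_mul_cos_add_sin_mul_I hρ ⟨by linarith [Real.pi_pos], hθ⟩,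
      if_neg h0.not_gt]
  · have : Complex.exp (θ * Complex.I) = Complex.exp (((θ - 2 * Real.pi : ℝ) : ℂ) * Complex.I) := by
      push_cast
      rw [sub_mul, Complex.exp_periodic.sub_eq]
    rw [this, Complex.exp_mul_I,
      Complex.arg_mul_cos_add_sin_mul_I hρ ⟨by linarith, by linarith⟩, if_pos (by linarith)]
    ring

lemma angFrom_self {c h : Pt} (hh : h ≠ c) : angFrom c h h = 0 :=
  angFrom_eq_of_polar (ρ := 1) hh one_pos le_rfl (by positivity) (by simp)

/-- Changing the reference direction shifts the angles. -/
lemma angFrom_change_of_le {c q r x : Pt} (hq : q ≠ c) (hr : r ≠ c) (hx : x ≠ c)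
    (hle : angFrom c q r ≤ angFrom c q x) :
    angFrom c r x = angFrom c q x - angFrom c q r := by
  obtain ⟨ρ, hρ, hρx⟩ := exists_polar hq hx
  obtain ⟨σ, hσ, hσr⟩ := exists_polar hq hr
  refine angFrom_eq_of_polar (ρ := ρ / σ) hr (by positivity) (by linarith)
    (by linarith [angFrom_nonneg c q r, angFrom_lt c q x]) ?_
  rw [hρx, hσr]
  push_cast
  rw [sub_mul, Complex.exp_sub]
  have := Complex.exp_ne_zero (angFrom c q r * Complex.I)
  have : (σ : ℂ) ≠ 0 := by exact_mod_cast hσ.ne'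
  field_simp

lemma angFrom_comm {c q r : Pt} (hq : q ≠ c) (hr : r ≠ c) (h : 0 < angFrom c q r) :
    angFrom c r q = 2 * Real.pi - angFrom c q r := by
  obtain ⟨σ, hσ, hσr⟩ := exists_polar hq hr
  refine angFrom_eq_of_polar (ρ := 1 / σ) hr (by positivity) (by linarith [angFrom_lt c q r])
    (by linarith) ?_
  rw [hσr]
  push_cast
  rw [sub_mul, Complex.exp_sub, Complex.exp_two_pi_mul_I]
  have := Complex.exp_ne_zero (angFrom c q r * Complex.I)
  have : (σ : ℂ) ≠ 0 := by exact_mod_cast hσ.ne'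
  field_simp

lemma sign3_eq_im (c x y : Pt) :
    sign3 c x y = ((starRingEnd ℂ) (toC x - toC c) * (toC y - toC c)).im := by
  simp [sign3, toC]; ring

lemma exists_sign3_eq_sin {c h x y : Pt} (hh : h ≠ c) (hx : x ≠ c) (hy : y ≠ c) :
    ∃ K : ℝ, 0 < K ∧ sign3 c x y = K * Real.sin (angFrom c h y - angFrom c h x) := by
  obtain ⟨ρ, hρ, hρx⟩ := exists_polar hh hx
  obtain ⟨σ, hσ, hσy⟩ := exists_polar hh hy
  refine ⟨ρ * σ * Complex.normSq (toC h - toC c),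
    mul_pos (mul_pos hρ hσ) (Complex.normSq_pos.2 (toC_sub_ne_zero hh)), ?_⟩
  rw [sign3_eq_im, hρx, hσy, Real.sin_sub, Complex.normSq_apply, Complex.exp_mul_I,
    Complex.exp_mul_I, ← Complex.ofReal_cos, ← Complex.ofReal_cos, ← Complex.ofReal_sin,
    ← Complex.ofReal_sin]
  simp [-Complex.ofReal_cos, -Complex.ofReal_sin]
  ring

lemma sign3_pos_iff {c h x y : Pt} (hh : h ≠ c) (hx : x ≠ c) (hy : y ≠ c) :
    0 < sign3 c x y ↔
      (angFrom c h x < angFrom c h y ∧ angFrom c h y < angFrom c h x + Real.pi) ∨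
        angFrom c h y + Real.pi < angFrom c h x := by
  obtain ⟨K, hK, hs⟩ := exists_sign3_eq_sin hh hx hy
  rw [hs, mul_pos_iff_of_pos_left hK]
  have hx0 := angFrom_nonneg c h x
  have hx1 := angFrom_lt c h x
  have hy0 := angFrom_nonneg c h y
  have hy1 := angFrom_lt c h y
  constructor
  · intro hpos
    by_contra! hcon
    obtain ⟨h1, h2⟩ := hcon
    refine hpos.not_ge ?_
    rcases le_or_gt (angFrom c h y) (angFrom c h x) with h3 | h3
    · exact Real.sin_nonpos_of_nonpos_of_neg_pi_le (by linarith) (by linarith)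
    · have h4 := h1 h3
      rw [← Real.sin_sub_two_pi]
      exact Real.sin_nonpos_of_nonpos_of_neg_pi_le (by linarith) (by linarith)
  · rintro (⟨h1, h2⟩ | h1)
    · exact Real.sin_pos_of_pos_of_lt_pi (by linarith) (by linarith)
    · rw [← Real.sin_add_two_pi]
      exact Real.sin_pos_of_pos_of_lt_pi (by linarith) (by linarith)

lemma angFrom_eq_of_mem_openSegment {c h x z : Pt} (hh : h ≠ c) (hx : x ≠ c)
    (hz : z ∈ openSegment ℝ c x) : angFrom c h z = angFrom c h x := by
  obtain ⟨s, t, hs, ht, hst, rfl⟩ := hz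
  obtain ⟨ρ, hρ, hρx⟩ := exists_polar hh hx
  refine angFrom_eq_of_polar (ρ := t * ρ) hh (by positivity) (angFrom_nonneg _ _ _)
    (angFrom_lt _ _ _) ?_
  have : toC (s • c + t • x) - toC c = t * (toC x - toC c) := by
    obtain rfl : s = 1 - t := by linarith
    apply Complex.ext <;> simp [toC] <;> ring
  rw [this, hρx]
  push_cast
  ring

lemma angFrom_mem_Ioo_of_mem_openSegment {c h x y z : Pt} (hh : h ≠ c) (hx : x ≠ c) (hy : y ≠ c)
    (hxy : angFrom c h x < angFrom c h y) (hpos : 0 < sign3 c x y)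
    (hz : z ∈ openSegment ℝ x y) :
    angFrom c h x < angFrom c h z ∧ angFrom c h z < angFrom c h y := by
  obtain ⟨s, t, hs, ht, hst, hcomb⟩ := exists_sign3_of_mem_openSegment hz
  have h1 : 0 < sign3 c x z := by
    rw [hcomb]; simpa using mul_pos ht hpos
  have h2 : 0 < sign3 c z y := by
    rw [sign3_swap, hcomb, sign3_swap c x y]; simpa using mul_pos hs hpos
  have hzc : z ≠ c := by
    rintro rfl
    simp at h1
  rw [sign3_pos_iff hh hx hy] at hpos
  rw [sign3_pos_iff hh hx hzc] at h1
  rw [sign3_pos_iff hh hzc hy] at h2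
  have := Real.pi_pos
  rcases hpos with ⟨_, hpos⟩ | hpos <;> rcases h1 with ⟨h1, h1'⟩ | h1 <;>
    rcases h2 with ⟨h2, h2'⟩ | h2 <;> constructor <;> linarith

/-! ### Lists of edges -/

lemma pathEdges_cons_cons (x y : Pt) (l : List Pt) :
    pathEdges (x :: y :: l) = (x, y) :: pathEdges (y :: l) := rfl

lemma pathEdges_append_cons_cons (l₁ l₂ : List Pt) (x y : Pt) :
    pathEdges (l₁ ++ x :: y :: l₂) = pathEdges (l₁ ++ [x]) ++ (x, y) :: pathEdges (y :: l₂) := by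
  induction l₁ with
  | nil => rfl
  | cons a l₁ ih =>
    cases l₁ with
    | nil => rfl
    | cons b l₁ => simpa [pathEdges_cons_cons] using ih

lemma cycleEdges_cons (c : Pt) (l : List Pt) :
    cycleEdges (c :: l) = pathEdges (c :: (l ++ [c])) := by
  have h : ∀ l₁ l₂ : List Pt, l₁.length = l₂.length →
      List.zip (l₁ ++ [c]) l₂ = List.zip l₁ l₂ := by
    intro l₁ l₂ hl
    simpa using List.zip_append (l₁ := l₁) (r₁ := [c]) (l₂ := l₂) (r₂ := []) hl
  unfold cycleEdges pathEdges
  rw [← List.cons_append, h]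
  · simp
  · simp

lemma fst_mem_of_mem_pathEdges {l : List Pt} {x : Pt} {e : Pt × Pt}
    (he : e ∈ pathEdges (l ++ [x])) : e.1 ∈ l := by
  induction l with
  | nil => simp [pathEdges] at he
  | cons a l ih =>
    cases l with
    | nil =>
      obtain rfl : e = (a, x) := by simpa [pathEdges] using he
      simp
    | cons b l =>
      rcases List.mem_cons.1 (show e ∈ (a, b) :: pathEdges (b :: l ++ [x]) from he) with rfl | he
      · simp
      · exact List.mem_cons_of_mem _ (ih he)

lemma snd_mem_of_mem_pathEdges {l : List Pt} {x : Pt} {e : Pt × Pt}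
    (he : e ∈ pathEdges (x :: l)) : e.2 ∈ l :=
  (List.of_mem_zip (show (e.1, e.2) ∈ List.zip (x :: l) l from he)).2

lemma mem_of_mem_pathEdges {l : List Pt} {e : Pt × Pt} (he : e ∈ pathEdges l) :
    e.1 ∈ l ∧ e.2 ∈ l :=
  have h := List.of_mem_zip (show (e.1, e.2) ∈ List.zip l l.tail from he)
  ⟨h.1, List.mem_of_mem_tail h.2⟩

lemma fst_ne_snd_of_mem_pathEdges {l : List Pt} (hl : l.Nodup) {e : Pt × Pt}
    (he : e ∈ pathEdges l) : e.1 ≠ e.2 := by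
  induction l with
  | nil => simp [pathEdges] at he
  | cons a l ih =>
    cases l with
    | nil => simp [pathEdges] at he
    | cons b l =>
      rcases List.mem_cons.1 (pathEdges_cons_cons a b l ▸ he) with rfl | he
      · intro h
        obtain rfl : a = b := h
        simp at hl
      · exact ih hl.of_cons he

/-- No segment between points of `T` meets the open segment `xy`, unless both of its endpoints
belong to `{x, y}`. -/
def Unc (T : Finset Pt) (x y : Pt) : Prop :=
  ∀ a ∈ T, ∀ b ∈ T, a ≠ x → a ≠ y → SegDisj (x, y) (a, b)

lemma Unc.symm {T : Finset Pt} {x y : Pt} (h : Unc T x y) : Unc T y x :=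
  fun a ha b hb hay hax => (h a ha b hb hax hay).swap_left

/-- Two plane paths can be joined along an uncrossed edge. -/
lemma nonCrossing_append {T : Finset Pt} {l₁ l₂ : List Pt} {x y : Pt} (hx : x ∈ T) (hy : y ∈ T)
    (h₁ : ∀ z ∈ l₁, z ∈ T ∧ z ≠ x ∧ z ≠ y) (h₂ : ∀ z ∈ l₂, z ∈ T ∧ z ≠ x ∧ z ≠ y)
    (hxy : Unc T x y) (hN₁ : NonCrossing (pathEdges (l₁ ++ [x])))
    (hN₂ : NonCrossing (pathEdges (y :: l₂)))
    (hN : ∀ e ∈ pathEdges (l₁ ++ [x]), ∀ f ∈ pathEdges (y :: l₂), SegDisj e f) :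
    NonCrossing (pathEdges (l₁ ++ x :: y :: l₂)) := by
  rw [pathEdges_append_cons_cons]
  refine List.pairwise_append.2 ⟨hN₁, List.pairwise_cons.2 ⟨fun f hf => ?_, hN₂⟩,
    fun e he f hf => ?_⟩
  · have hf₂ := h₂ _ (snd_mem_of_mem_pathEdges hf)
    have hf₁ : f.1 ∈ T := by
      rcases List.mem_cons.1 (mem_of_mem_pathEdges hf).1 with h | h
      · rwa [h]
      · exact (h₂ _ h).1
    exact (hxy _ hf₂.1 _ hf₁ hf₂.2.1 hf₂.2.2).swap_right
  · rcases List.mem_cons.1 hf with rfl | hf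
    · have he₁ := h₁ _ (fst_mem_of_mem_pathEdges he)
      have he₂ : e.2 ∈ T := by
        rcases List.mem_append.1 (mem_of_mem_pathEdges he).2 with h | h
        · exact (h₁ _ h).1
        · rwa [List.mem_singleton.1 h]
      exact (hxy _ he₁.1 _ he₂ he₁.2.1 he₁.2.2).symm
    · exact hN e he f hf

lemma exists_list_sorted (T : Finset Pt) (f : Pt → ℝ) (hf : Set.InjOn f T) :
    ∃ L : List Pt, L.toFinset = T ∧ L.Pairwise (fun x y => f x < f y) := by
  induction T using Finset.induction_on_min_value f with
  | empty => exact ⟨[], by simp⟩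
  | insert a s ha hmin ih =>
    obtain ⟨L, rfl, hL⟩ := ih (hf.mono (by simp))
    refine ⟨a :: L, by simp, List.pairwise_cons.2 ⟨fun z hz => ?_, hL⟩⟩
    refine lt_of_le_of_ne (hmin z (by simpa using hz)) fun h => ha ?_
    rw [hf (by simp) (by simp at hz ⊢; exact Or.inr hz) h]
    simpa using hz

lemma nodup_of_sorted {L : List Pt} {f : Pt → ℝ} (hL : L.Pairwise (fun x y => f x < f y)) :
    L.Nodup :=
  hL.imp fun h => by rintro rfl; exact lt_irrefl _ h

lemma exists_eq_cons_of_sorted {L : List Pt} {f : Pt → ℝ}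
    (hL : L.Pairwise (fun x y => f x < f y)) {p : Pt} (hp : p ∈ L) (hmin : ∀ z ∈ L, f p ≤ f z) :
    ∃ L', L = p :: L' := by
  cases L with
  | nil => simp at hp
  | cons a L =>
    rcases List.mem_cons.1 hp with rfl | hp
    · exact ⟨L, rfl⟩
    · exact absurd (List.rel_of_pairwise_cons hL hp) (hmin a (by simp)).not_gt

lemma exists_eq_concat_of_sorted {L : List Pt} {f : Pt → ℝ}
    (hL : L.Pairwise (fun x y => f x < f y)) {p : Pt} (hp : p ∈ L) (hmax : ∀ z ∈ L, f z ≤ f p) :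
    ∃ L', L = L' ++ [p] := by
  obtain ⟨l₁, l₂, rfl⟩ := List.append_of_mem hp
  cases l₂ with
  | nil => exact ⟨l₁, rfl⟩
  | cons a l₂ =>
    exact absurd (List.rel_of_pairwise_cons (List.pairwise_append.1 hL).2.1 (by simp))
      (hmax a (by simp)).not_gt

lemma exists_split_of_not_isChain {α : Type*} {R : α → α → Prop} {L : List α}
    (h : ¬ L.IsChain R) : ∃ l₁ x y l₂, L = l₁ ++ x :: y :: l₂ ∧ ¬ R x y := by
  induction L with
  | nil => simp at h
  | cons a L ih =>
    cases L with
    | nil => simp at h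
    | cons b L =>
      by_cases hab : R a b
      · obtain ⟨l₁, x, y, l₂, hL, hxy⟩ := ih fun hc => h (List.isChain_cons_cons.2 ⟨hab, hc⟩)
        exact ⟨a :: l₁, x, y, l₂, by rw [hL]; rfl, hxy⟩
      · exact ⟨[], a, b, L, rfl, hab⟩

/-- In a sorted list, no member lies strictly between two consecutive members. -/
lemma sorted_split_trichotomy {l₁ l₂ : List Pt} {x y z : Pt} {f : Pt → ℝ}
    (hL : (l₁ ++ x :: y :: l₂).Pairwise (fun x y => f x < f y)) (hz : z ∈ l₁ ++ x :: y :: l₂) :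
    f x < f y ∧ (z = x ∨ z = y ∨ f z < f x ∨ f y < f z) := by
  simp only [List.pairwise_append, List.pairwise_cons, List.mem_append, List.mem_cons] at hL hz
  grind

/-! ### Radially sorted point lists -/

lemma radial_chain {c h w : Pt} {L : List Pt} (hh : h ≠ c) (hne : ∀ z ∈ w :: L, z ≠ c)
    (hL : (w :: L).IsChain
      (fun x y => angFrom c h x < angFrom c h y ∧ 0 < sign3 c x y)) :
    NonCrossing (pathEdges (w :: L)) ∧ ∀ e ∈ pathEdges (w :: L), ∀ z ∈ openSegment ℝ e.1 e.2,
      angFrom c h w < angFrom c h z ∧ ∃ u ∈ L, angFrom c h z < angFrom c h u := by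
  induction L generalizing w with
  | nil => simp [NonCrossing, pathEdges]
  | cons y L ih =>
    obtain ⟨⟨hwy, hpos⟩, hL⟩ := List.isChain_cons_cons.1 hL
    obtain ⟨ih₁, ih₂⟩ := ih (fun z hz => hne z (List.mem_cons_of_mem _ hz)) hL
    have hfirst : ∀ z ∈ openSegment ℝ w y, angFrom c h w < angFrom c h z ∧
        angFrom c h z < angFrom c h y := fun z hz =>
      angFrom_mem_Ioo_of_mem_openSegment hh (hne w (by simp)) (hne y (by simp)) hwy hpos hz
    rw [pathEdges_cons_cons]
    refine ⟨List.pairwise_cons.2 ⟨fun f hf => segDisj_iff.2 fun z hz hz' => ?_, ih₁⟩,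
      fun e he z hz => ?_⟩
    · exact lt_asymm (hfirst z hz).2 (ih₂ f hf z hz').1
    · rcases List.mem_cons.1 he with rfl | he
      · exact ⟨(hfirst z hz).1, y, by simp, (hfirst z hz).2⟩
      · obtain ⟨h1, u, hu, h2⟩ := ih₂ e he z hz
        exact ⟨hwy.trans h1, u, List.mem_cons_of_mem _ hu, h2⟩

lemma radial_path {c h w : Pt} {L : List Pt} (hh : h ≠ c) (hne : ∀ z ∈ w :: L, z ≠ c)
    (hL : (w :: L).IsChain
      (fun x y => angFrom c h x < angFrom c h y ∧ 0 < sign3 c x y)) :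
    NonCrossing (pathEdges (c :: w :: L)) := by
  obtain ⟨h₁, h₂⟩ := radial_chain hh hne hL
  refine List.pairwise_cons.2 ⟨fun f hf => segDisj_iff.2 fun z hz hz' => ?_, h₁⟩
  have := (h₂ f hf z hz').1
  rw [angFrom_eq_of_mem_openSegment hh (hne w (by simp)) hz] at this
  exact lt_irrefl _ this

lemma radial_cycle {c h w u : Pt} {L : List Pt} (hh : h ≠ c) (hne : ∀ z ∈ w :: (L ++ [u]), z ≠ c)
    (hs : (w :: (L ++ [u])).Pairwise (fun x y => angFrom c h x < angFrom c h y))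
    (hL : (w :: (L ++ [u])).IsChain
      (fun x y => angFrom c h x < angFrom c h y ∧ 0 < sign3 c x y)) :
    NonCrossing (cycleEdges (c :: w :: (L ++ [u]))) := by
  have hp := radial_path hh hne hL
  obtain ⟨h₁, h₂⟩ := radial_chain hh hne hL
  have huc : u ≠ c := hne u (by simp)
  have hsu : ∀ z ∈ w :: L, angFrom c h z < angFrom c h u := by
    rw [← List.cons_append, List.pairwise_append] at hs
    exact fun z hz => hs.2.2 z hz u (by simp)
  have heq : cycleEdges (c :: w :: (L ++ [u])) = pathEdges (c :: w :: (L ++ [u])) ++ [(u, c)] := by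
    rw [cycleEdges_cons]
    simpa [pathEdges] using pathEdges_append_cons_cons (c :: w :: L) [] u c
  rw [heq]
  refine List.pairwise_append.2 ⟨hp, by simp, fun e he f hf => ?_⟩
  obtain rfl := List.mem_singleton.1 hf
  refine segDisj_iff.2 fun z hz hz' => ?_
  rw [openSegment_symm] at hz'
  have hzu := angFrom_eq_of_mem_openSegment hh huc hz'
  rcases List.mem_cons.1 (show e ∈ (c, w) :: pathEdges (w :: (L ++ [u])) from he) with rfl | he
  · rw [angFrom_eq_of_mem_openSegment hh (hne w (by simp)) hz] at hzu
    exact (hsu w (by simp)).ne hzu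
  · obtain ⟨-, x, hx, hzx⟩ := h₂ e he z hz
    rcases List.mem_append.1 hx with hx | hx
    · exact lt_asymm (hzu ▸ hzx) (hsu x (List.mem_cons_of_mem _ hx))
    · rw [List.mem_singleton.1 hx] at hzx
      exact hzx.ne hzu

/-! ### Hull edges and extreme points -/

lemma GenPos.mono {S T : Finset Pt} (hS : GenPos S) (h : T ⊆ S) : GenPos T :=
  fun p hp q hq r hr => hS p (h hp) q (h hq) r (h hr)

/-- All points of `T` other than `u`, `v` lie strictly to the left of the ray from `u` to `v`. -/
def Supports (T : Finset Pt) (u v : Pt) : Prop :=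
  u ≠ v ∧ ∀ z ∈ T, z ≠ u → z ≠ v → 0 < sign3 u v z

/-- `u` lies on a line supporting `T`, which meets `T` in at most one further point, on a fixed
side of `u`. -/
def OnHull (T : Finset Pt) (u : Pt) : Prop := ∃ v, Supports T u v

lemma OnHull.mono {S T : Finset Pt} {u : Pt} (hu : OnHull S u) (h : T ⊆ S) : OnHull T u :=
  let ⟨v, hne, hv⟩ := hu
  ⟨v, hne, fun z hz => hv z (h hz)⟩

lemma Supports.unc {T : Finset Pt} {u v : Pt} (h : Supports T u v) : Unc T u v := by
  intro a ha b hb hau hav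
  have hpos := h.2 a ha hau hav
  refine segDisj_of_nonpos_of_pos u v (by simp) (by simp) hpos.le ?_ (Or.inl hpos)
  by_cases hbu : b = u
  · simp [hbu]
  by_cases hbv : b = v
  · simp [hbv]
  exact (h.2 b hb hbu hbv).le

lemma angFrom_ne {S : Finset Pt} (hS : GenPos S) {c h x y : Pt} (hc : c ∈ S) (hx : x ∈ S)
    (hy : y ∈ S) (hh : h ≠ c) (hxc : x ≠ c) (hyc : y ≠ c) (hxy : x ≠ y) :
    angFrom c h x ≠ angFrom c h y := by
  intro heq
  obtain ⟨K, -, hs⟩ := exists_sign3_eq_sin hh hxc hyc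
  rw [heq, sub_self, Real.sin_zero, mul_zero] at hs
  exact sign3_ne_zero hS hc hx hy hxc.symm hyc.symm hxy hs

lemma Supports.angFrom_lt_pi {T : Finset Pt} {u v z : Pt} (h : Supports T u v) (hz : z ∈ T)
    (hzu : z ≠ u) : angFrom u v z < Real.pi := by
  by_cases hzv : z = v
  · rw [hzv, angFrom_self h.1.symm]; exact Real.pi_pos
  · have := h.2 z hz hzu hzv
    rw [sign3_pos_iff h.1.symm h.1.symm hzu, angFrom_self h.1.symm] at this
    rcases this with ⟨-, h1⟩ | h1
    · linarith
    · linarith [angFrom_nonneg u v z, Real.pi_pos]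

lemma Supports.pi_lt_angFrom {T : Finset Pt} {u v z : Pt} (h : Supports T u v) (hz : z ∈ T)
    (hzu : z ≠ u) (hzv : z ≠ v) : Real.pi < angFrom v u z := by
  have := h.2 z hz hzu hzv
  rw [← sign3_rotate, sign3_pos_iff h.1 hzv h.1, angFrom_self h.1] at this
  rcases this with ⟨h1, -⟩ | h1
  · linarith [angFrom_nonneg v u z]
  · linarith

lemma Supports.sign3_pos_iff_lt {T : Finset Pt} {u v x y : Pt} (h : Supports T u v) (hx : x ∈ T)
    (hy : y ∈ T) (hxu : x ≠ u) (hyu : y ≠ u) :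
    0 < sign3 u x y ↔ angFrom u v x < angFrom u v y := by
  rw [sign3_pos_iff h.1.symm hxu hyu]
  have := h.angFrom_lt_pi hx hxu
  have := h.angFrom_lt_pi hy hyu
  have := angFrom_nonneg u v x
  have := angFrom_nonneg u v y
  constructor
  · rintro (h | h) <;> linarith
  · intro h; left; constructor <;> linarith

lemma OnHull.exists_next {T : Finset Pt} (hT : GenPos T) {u p : Pt} (hu : OnHull T u)
    (huT : u ∈ T) (hp : p ∈ T) (hpu : p ≠ u) : ∃ v ∈ T, Supports T u v := by
  obtain ⟨w, hw⟩ := hu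
  obtain ⟨v, hv, hmin⟩ := (T.erase u).exists_min_image (angFrom u w) ⟨p, by simp [hp, hpu]⟩
  simp only [Finset.mem_erase] at hv hmin
  refine ⟨v, hv.2, hv.1.symm, fun z hz hzu hzv => ?_⟩
  rw [hw.sign3_pos_iff_lt hv.2 hz hv.1 hzu]
  exact lt_of_le_of_ne (hmin z ⟨hzu, hz⟩) (angFrom_ne hT huT hv.2 hz hw.1.symm hv.1 hzu hzv.symm)

lemma OnHull.exists_prev {T : Finset Pt} (hT : GenPos T) {u p : Pt} (hu : OnHull T u)
    (huT : u ∈ T) (hp : p ∈ T) (hpu : p ≠ u) : ∃ v ∈ T, Supports T v u := by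
  obtain ⟨w, hw⟩ := hu
  obtain ⟨v, hv, hmax⟩ := (T.erase u).exists_max_image (angFrom u w) ⟨p, by simp [hp, hpu]⟩
  simp only [Finset.mem_erase] at hv hmax
  refine ⟨v, hv.2, hv.1, fun z hz hzv hzu => ?_⟩
  rw [← sign3_rotate, hw.sign3_pos_iff_lt hz hv.2 hzu hv.1]
  exact lt_of_le_of_ne (hmax z ⟨hzu, hz⟩) (angFrom_ne hT huT hz hv.2 hw.1.symm hzu hv.1 hzv)

lemma Supports.onHull_right {T : Finset Pt} (hT : GenPos T) {u v : Pt} (h : Supports T u v)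
    (hv : v ∈ T) : OnHull T v := by
  rcases ((T.erase v).erase u).eq_empty_or_nonempty with he | he
  · refine ⟨u, h.1.symm, fun z hz hzv hzu => ?_⟩
    have : z ∈ (T.erase v).erase u := by simp only [Finset.mem_erase]; exact ⟨hzu, hzv, hz⟩
    simp [he] at this
  · obtain ⟨w, hw, hmin⟩ := Finset.exists_min_image _ (angFrom v u) he
    simp only [Finset.mem_erase] at hw hmin
    refine ⟨w, hw.2.1.symm, fun z hz hzv hzw => ?_⟩
    by_cases hzu : z = u
    · rw [hzu, ← sign3_rotate]
      rw [← sign3_rotate]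
      exact h.2 w hw.2.2 hw.1 hw.2.1
    · rw [sign3_pos_iff h.1 hw.2.1 hzv]
      left
      have := h.pi_lt_angFrom hw.2.2 hw.1 hw.2.1
      have := angFrom_lt v u z
      exact ⟨lt_of_le_of_ne (hmin z ⟨hzu, hzv, hz⟩)
        (angFrom_ne hT hv hw.2.2 hz h.1 hw.2.1 hzv hzw.symm), by linarith⟩

/-- Any two points on the hull are the endpoints of a plane spanning path. -/
lemma exists_planePath_between {T : Finset Pt} (hT : GenPos T) {u v : Pt} (hu : u ∈ T)
    (hv : v ∈ T) (huv : u ≠ v) (hue : OnHull T u) (hve : OnHull T v) :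
    ∃ l, IsPlanePath T (u :: (l ++ [v])) := by
  induction T using Finset.strongInduction generalizing u with
  | H T ih =>
    by_cases hpair : ∀ z ∈ T, z = u ∨ z = v
    · refine ⟨[], by simpa using huv, ?_, by simp [NonCrossing, pathEdges]⟩
      ext z
      simp only [List.nil_append, List.mem_toFinset, List.mem_cons, List.not_mem_nil, or_false]
      exact ⟨by rintro (rfl | rfl) <;> assumption, hpair z⟩
    · push Not at hpair
      obtain ⟨p, hp, hpu, hpv⟩ := hpair
      have hsub : T.erase u ⊆ T := Finset.erase_subset _ _
      have hT' := hT.mono hsub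
      have hstep : ∃ w ∈ T, w ≠ u ∧ w ≠ v ∧ Unc T u w ∧ OnHull T w := by
        obtain ⟨w, hw, hs⟩ := hue.exists_next hT hu hp hpu
        by_cases hwv : w = v
        · subst hwv
          obtain ⟨w', hw', hs'⟩ := hue.exists_prev hT hu hp hpu
          refine ⟨w', hw', hs'.1, ?_, hs'.unc.symm, ⟨u, hs'⟩⟩
          rintro rfl
          have h₁ := hs.2 p hp hpu hpv
          have h₂ := hs'.2 p hp hpv hpu
          rw [← sign3_rotate, sign3_swap] at h₂
          linarith
        · exact ⟨w, hw, hs.1.symm, hwv, hs.unc, hs.onHull_right hT hw⟩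
      obtain ⟨w, hw, hwu, hwv, hunc, hwe⟩ := hstep
      obtain ⟨l, hnd, hset, hN⟩ := ih (T.erase u) (Finset.erase_ssubset hu) hT'
        (u := w) (by simp [hw, hwu]) (by simp [hv, huv.symm]) hwv (hwe.mono hsub) (hve.mono hsub)
      have hmem : ∀ z, z ∈ w :: (l ++ [v]) ↔ z ≠ u ∧ z ∈ T := fun z => by
        rw [← List.mem_toFinset, hset, Finset.mem_erase]
      refine ⟨w :: l, List.nodup_cons.2 ⟨fun h => ((hmem u).1 h).1 rfl, hnd⟩, ?_, ?_⟩
      · rw [List.toFinset_cons, List.cons_append, hset, Finset.insert_erase hu]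
      · refine nonCrossing_append (T := T) (l₁ := []) hu hw (by simp) (fun z hz => ?_) hunc
          (by simp [NonCrossing, pathEdges]) hN (by simp [pathEdges])
        obtain ⟨hzu, hzT⟩ := (hmem z).1 (List.mem_cons_of_mem _ hz)
        refine ⟨hzT, hzu, ?_⟩
        rintro rfl
        exact (List.nodup_cons.1 hnd).1 hz

/-! ### Viable starting edges -/

/-- If some wedge between radially consecutive points is reflex, the center is on the hull. -/
lemma isChain_or_onHull {S : Finset Pt} (hS : GenPos S) {c h : Pt} {L : List Pt} (hc : c ∈ S)
    (hh : h ≠ c) (hLS : ∀ z ∈ L, z ∈ S ∧ z ≠ c) (hcov : ∀ z ∈ S, z ≠ c → z ≠ h → z ∈ L)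
    (hL : L.Pairwise (fun x y => angFrom c h x < angFrom c h y)) :
    L.IsChain (fun x y => angFrom c h x < angFrom c h y ∧ 0 < sign3 c x y) ∨ OnHull S c := by
  by_contra! hcon
  obtain ⟨hnc, hno⟩ := hcon
  obtain ⟨l₁, x, y, l₂, rfl, hxy⟩ := exists_split_of_not_isChain hnc
  have hx := hLS x (by simp)
  have hy := hLS y (by simp)
  have hlt := (sorted_split_trichotomy hL (z := x) (by simp)).1
  have hneg : ¬ 0 < sign3 c x y := fun h => hxy ⟨hlt, h⟩
  have hne : sign3 c y x ≠ 0 := sign3_ne_zero hS hc hy.1 hx.1 hy.2.symm hx.2.symm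
    (by rintro rfl; exact lt_irrefl _ hlt)
  have hpos : 0 < sign3 c y x := by
    refine lt_of_le_of_ne ?_ hne.symm
    rw [sign3_swap]
    linarith
  rw [sign3_pos_iff hh hy.2 hx.2] at hpos
  have hgap : angFrom c h x + Real.pi < angFrom c h y := by
    rcases hpos with hpos | hpos
    · linarith [hpos.1]
    · exact hpos
  have hx0 := angFrom_nonneg c h x
  refine hno ⟨y, hy.2.symm, fun z hz hzc hzy => ?_⟩
  rw [sign3_pos_iff hh hy.2 hzc]
  have hz1 := angFrom_lt c h z
  by_cases hzh : z = h
  · right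
    rw [hzh, angFrom_self hh]
    linarith
  · rcases (sorted_split_trichotomy hL (hcov z hz hzc hzh)).2 with rfl | rfl | h1 | h1
    · exact Or.inr hgap
    · exact absurd rfl hzy
    · exact Or.inr (by linarith)
    · exact Or.inl ⟨h1, by linarith⟩

lemma exists_list_radial {S : Finset Pt} (hS : GenPos S) {c h : Pt} (hc : c ∈ S) (hh : h ≠ c)
    {T : Finset Pt} (hT : T ⊆ S.erase c) :
    ∃ L : List Pt, (∀ z, z ∈ L ↔ z ∈ T) ∧
      L.Pairwise (fun x y => angFrom c h x < angFrom c h y) := by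
  obtain ⟨L, rfl, hL⟩ := exists_list_sorted T (angFrom c h) fun x hx y hy hxy => by
    by_contra hne
    have hx := Finset.mem_erase.1 (hT hx)
    have hy := Finset.mem_erase.1 (hT hy)
    exact angFrom_ne hS hc hx.2 hy.2 hh hx.1 hy.1 hne hxy
  exact ⟨L, by simp, hL⟩

/-- Visiting all points in radial order around the second vertex gives a plane path. -/
lemma viable_of_isChain {S : Finset Pt} {v p : Pt} {L : List Pt} (hv : v ∈ S) (hp : p ∈ S)
    (hvp : v ≠ p) (hmem : ∀ z, z ∈ L ↔ z ∈ (S.erase p).erase v)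
    (hs : L.Pairwise (fun x y => angFrom p v x < angFrom p v y))
    (hL : L.IsChain (fun x y => angFrom p v x < angFrom p v y ∧ 0 < sign3 p x y))
    (hS : GenPos S) : Viable S v p := by
  simp only [Finset.mem_erase] at hmem
  refine ⟨L, ?_, ?_, ?_⟩
  · have := nodup_of_sorted hs
    simp [hmem, hvp, this]
  · ext z
    simp only [List.mem_toFinset, List.mem_cons, hmem]
    by_cases h1 : z = v <;> by_cases h2 : z = p <;> simp [*]
  · cases L with
    | nil => simp [NonCrossing, pathEdges]
    | cons w L =>
      have hne : ∀ z ∈ w :: L, z ≠ p := fun z hz => ((hmem z).1 hz).2.1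
      have hw := (hmem w).1 (by simp)
      refine List.pairwise_cons.2 ⟨fun f hf => segDisj_iff.2 fun z hz hz' => ?_,
        radial_path hvp hne hL⟩
      rw [openSegment_symm] at hz
      have hz0 : angFrom p v z = 0 := by
        rw [angFrom_eq_of_mem_openSegment hvp hvp hz, angFrom_self hvp]
      have hw0 : 0 < angFrom p v w := by
        rw [← angFrom_self hvp]
        refine lt_of_le_of_ne ?_ (angFrom_ne hS hp hv hw.2.2 hvp hvp hw.2.1 hw.1.symm)
        rw [angFrom_self hvp]
        exact angFrom_nonneg _ _ _
      rcases List.mem_cons.1 (show f ∈ (p, w) :: pathEdges (w :: L) from hf) with rfl | hf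
      · rw [angFrom_eq_of_mem_openSegment hvp hw.2.1 hz'] at hz0
        exact hw0.ne' hz0
      · have := ((radial_chain hvp hne hL).2 f hf z hz').1
        linarith

lemma viable_of_not_onHull_right {S : Finset Pt} (hS : GenPos S) {v p : Pt} (hv : v ∈ S)
    (hp : p ∈ S) (hvp : v ≠ p) (h : ¬ OnHull S p) : Viable S v p := by
  obtain ⟨L, hmem, hs⟩ := exists_list_radial hS hp hvp
    (T := (S.erase p).erase v) (Finset.erase_subset _ _)
  refine viable_of_isChain hv hp hvp hmem hs ?_ hS
  refine (isChain_or_onHull hS hp hvp (fun z hz => ?_) (fun z hz h1 h2 => ?_) hs).resolve_right h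
  · have := (hmem z).1 hz
    simp only [Finset.mem_erase] at this
    exact ⟨this.2.2, this.2.1⟩
  · rw [hmem]; simp [*]

lemma viable_of_supports {S : Finset Pt} (hS : GenPos S) {v p : Pt} (hv : v ∈ S)
    (hp : p ∈ S) (h : Supports S v p ∨ Supports S p v) : Viable S v p := by
  have hvp : v ≠ p := h.elim (fun h => h.1) (fun h => h.1.symm)
  obtain ⟨L, hmem, hs⟩ := exists_list_radial hS hp hvp
    (T := (S.erase p).erase v) (Finset.erase_subset _ _)
  refine viable_of_isChain hv hp hvp hmem hs (List.Pairwise.isChain ?_) hS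
  refine hs.imp_of_mem fun {x y} hx hy hxy => ⟨hxy, ?_⟩
  simp only [hmem, Finset.mem_erase] at hx hy
  rw [sign3_pos_iff hvp hx.2.1 hy.2.1]
  refine Or.inl ⟨hxy, ?_⟩
  rcases h with h | h
  · linarith [h.pi_lt_angFrom hx.2.2 hx.1 hx.2.1, angFrom_lt p v y]
  · linarith [h.angFrom_lt_pi hy.2.2 hy.2.1, angFrom_nonneg p v x]

/-- A list of points containing points on both sides of a line has an edge crossing the line. -/
lemma exists_pathEdge_crossing {l : List Pt} {f : Pt → ℝ} (hf : ∀ z ∈ l, f z ≠ 0)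
    {a b : Pt} (ha : a ∈ l) (hb : b ∈ l) (hfa : f a < 0) (hfb : 0 < f b) :
    ∃ e ∈ pathEdges l, f e.1 * f e.2 < 0 := by
  by_contra! hcon
  have key : ∀ l : List Pt, (∀ e ∈ pathEdges l, 0 ≤ f e.1 * f e.2) → (∀ z ∈ l, f z ≠ 0) →
      ∀ x ∈ l, ∀ y ∈ l, 0 < f x * f y := by
    intro l
    induction l with
    | nil => simp
    | cons w l ih =>
      intro h hf
      cases l with
      | nil =>
        have := mul_self_pos.2 (hf w (by simp))
        simpa using this
      | cons w' l =>
        have hlt : 0 < f w * f w' := lt_of_le_of_ne (h (w, w') (by simp [pathEdges_cons_cons]))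
          (mul_ne_zero (hf w (by simp)) (hf w' (by simp))).symm
        have ih := ih (fun e he => h e (by simp [pathEdges_cons_cons, he]))
          fun z hz => hf z (List.mem_cons_of_mem _ hz)
        have hw : ∀ y ∈ w' :: l, 0 < f w * f y := by
          intro y hy
          have h1 := ih w' (by simp) y hy
          have h2 := mul_pos hlt h1
          have h3 := mul_self_pos.2 (hf w' (by simp))
          have h4 : f w * f w' * (f w' * f y) = (f w' * f w') * (f w * f y) := by ring
          rw [h4] at h2
          exact (mul_pos_iff_of_pos_left h3).1 h2
        intro x hx y hy
        rcases List.mem_cons.1 hx with hx | hx <;> rcases List.mem_cons.1 hy with hy | hy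
        · rw [hx, hy]; exact mul_self_pos.2 (hf w (by simp))
        · rw [hx]; exact hw y hy
        · rw [hy, mul_comm]; exact hw x hx
        · exact ih x hx y hy
  exact (key l hcon hf a ha b hb).not_gt (mul_neg_of_neg_of_pos hfa hfb)

/-- A point of the line `vp` that is on the inner side at both ends lies between `v` and `p`. -/
lemma mem_openSegment_of_sign3 {v p a w c : Pt} (hc : sign3 v p c = 0) (hap : 0 < sign3 v a p)
    (hac : 0 < sign3 v a c) (hwv : 0 < sign3 p w v) (hwc : 0 < sign3 p w c) :
    c ∈ openSegment ℝ v p := by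
  set t := sign3 v a c / sign3 v a p with ht
  have htp : t * sign3 v a p = sign3 v a c := div_mul_cancel₀ _ hap.ne'
  have h₁ : c.1 = (1 - t) * v.1 + t * p.1 := by
    refine mul_right_cancel₀ hap.ne' ?_
    have : (p.1 - v.1) * (t * sign3 v a p) = (p.1 - v.1) * sign3 v a c := by rw [htp]
    unfold sign3 at this hc ⊢
    linear_combination this * (-1) - (a.1 - v.1) * hc
  have h₂ : c.2 = (1 - t) * v.2 + t * p.2 := by
    refine mul_right_cancel₀ hap.ne' ?_
    have : (p.2 - v.2) * (t * sign3 v a p) = (p.2 - v.2) * sign3 v a c := by rw [htp]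
    unfold sign3 at this hc ⊢
    linear_combination this * (-1) - (a.2 - v.2) * hc
  have hw : sign3 p w c = (1 - t) * sign3 p w v := by
    unfold sign3
    rw [h₁, h₂]
    ring
  rw [hw] at hwc
  refine ⟨1 - t, t, (mul_pos_iff_of_pos_right hwv).1 hwc, by positivity, by ring, ?_⟩
  exact Prod.ext (by simp [h₁]) (by simp [h₂])

/-- A viable starting edge is not a chord joining two hull vertices. -/
lemma Viable.supports_of_onHull {S : Finset Pt} (hS : GenPos S) {v p a : Pt} (hv : v ∈ S)
    (hp : p ∈ S) (ha : a ∈ S) (hva : Supports S v a) (hpe : OnHull S p) (hpv : p ≠ v)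
    (hpa : p ≠ a) (hvia : Viable S v p) : Supports S p v := by
  obtain ⟨w, hw, hpw⟩ := hpe.exists_next hS hp hv hpv.symm
  by_contra hcon
  have hwv : w ≠ v := by rintro rfl; exact hcon hpw
  obtain ⟨b, hb, hbv, hbp, hbpos⟩ : ∃ b ∈ S, b ≠ v ∧ b ≠ p ∧ 0 < sign3 v p b := by
    refine ⟨w, hw, hwv, hpw.1.symm, ?_⟩
    rw [← sign3_rotate]
    exact hpw.2 v hv hpv.symm hwv.symm
  have hav : a ≠ v := hva.1.symm
  have haneg : sign3 v p a < 0 := by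
    rw [sign3_swap]
    exact neg_neg_of_pos (hva.2 p hp hpv hpa)
  obtain ⟨l, hnd, hset, hN⟩ := hvia
  have hmem : ∀ z, z ∈ l ↔ z ∈ S ∧ z ≠ v ∧ z ≠ p := by
    intro z
    rw [← hset]
    simp only [List.nodup_cons, List.mem_cons] at hnd
    simp only [List.mem_toFinset, List.mem_cons]
    grind
  obtain ⟨e, he, hlt⟩ := exists_pathEdge_crossing (l := l) (f := sign3 v p)
    (fun z hz => by
      obtain ⟨h1, h2, h3⟩ := (hmem z).1 hz
      exact sign3_ne_zero hS hv hp h1 hpv.symm h2.symm h3.symm)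
    ((hmem a).2 ⟨ha, hav, hpa.symm⟩) ((hmem b).2 ⟨hb, hbv, hbp⟩) haneg hbpos
  obtain ⟨x, y⟩ := e
  have hxy := mem_of_mem_pathEdges he
  obtain ⟨hxS, hxv, hxp⟩ := (hmem x).1 hxy.1
  obtain ⟨hyS, hyv, hyp⟩ := (hmem y).1 hxy.2
  have hxy : x ≠ y := by
    rintro rfl
    exact (mul_self_nonneg _).not_gt hlt
  have he' : (x, y) ∈ pathEdges (p :: l) := by
    cases l with
    | nil => simp [pathEdges] at he
    | cons b l => exact List.mem_cons_of_mem _ he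
  have hdisj : SegDisj (v, p) (x, y) := (List.pairwise_cons.1 hN).1 _ he'
  -- the point of the segment `xy` on the line `vp`
  set X := sign3 v p x with hX
  set Y := sign3 v p y with hY
  have hd : X - Y ≠ 0 := by
    intro h
    rw [sub_eq_zero] at h
    rw [h] at hlt
    exact (mul_self_nonneg _).not_gt hlt
  have hs : 0 < -Y / (X - Y) := by
    rw [div_pos_iff]
    rcases mul_neg_iff.1 hlt with ⟨h1, h2⟩ | ⟨h1, h2⟩
    · left; constructor <;> linarith
    · right; constructor <;> linarith
  have ht : 0 < X / (X - Y) := by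
    rw [div_pos_iff]
    rcases mul_neg_iff.1 hlt with ⟨h1, h2⟩ | ⟨h1, h2⟩
    · left; constructor <;> linarith
    · right; constructor <;> linarith
  have hst : -Y / (X - Y) + X / (X - Y) = 1 := by field_simp; ring
  set c : Pt := (-Y / (X - Y)) • x + (X / (X - Y)) • y with hc
  have hcmem : c ∈ openSegment ℝ x y := ⟨_, _, hs, ht, hst, rfl⟩
  have hc0 : sign3 v p c = 0 := by
    have : sign3 v p c = (-Y / (X - Y)) * sign3 v p x + (X / (X - Y)) * sign3 v p y := by
      have h1 : -Y / (X - Y) = 1 - X / (X - Y) := by linarith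
      rw [hc, h1]
      simp only [sign3, Prod.fst_add, Prod.snd_add, Prod.smul_fst, Prod.smul_snd, smul_eq_mul]
      ring
    rw [this, ← hX, ← hY]
    field_simp
    ring
  have hcpos : ∀ u w', Supports S u w' → x ≠ u → y ≠ u → 0 < sign3 u w' c := by
    intro u w' hsup hxu hyu
    have hx : x ≠ w' → 0 < sign3 u w' x := hsup.2 x hxS hxu
    have hy : y ≠ w' → 0 < sign3 u w' y := hsup.2 y hyS hyu
    refine sign3_pos_of_mem_openSegment hcmem ?_ ?_ ?_
    · by_cases h : x = w'
      · simp [h]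
      · exact (hx h).le
    · by_cases h : y = w'
      · simp [h]
      · exact (hy h).le
    · by_cases h : x = w'
      · exact Or.inr (hy fun h' => hxy (h.trans h'.symm))
      · exact Or.inl (hx h)
  have h1 := hcpos v a hva hxv hyv
  have h2 := hcpos p w hpw hxp hyp
  have hvap : 0 < sign3 v a p := hva.2 p hp hpv hpa
  have hpwv : 0 < sign3 p w v := hpw.2 v hv hpv.symm hwv.symm
  have hcv := mem_openSegment_of_sign3 hc0 hvap h1 hpwv h2
  exact segDisj_iff.1 hdisj c hcv hcmem

/-! ### Spanning cycles through the center -/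

lemma exists_planeCycle_of_list {S : Finset Pt} {c w u : Pt} {L l₁ l₂ : List Pt} (hc : c ∈ S)
    (hw : L = w :: l₁) (hu : L = l₂ ++ [u]) (hwu : w ≠ u) (hnd : L.Nodup)
    (hmem : ∀ z, z ∈ L ↔ z ≠ c ∧ z ∈ S) (hN : NonCrossing (cycleEdges (c :: L))) :
    ∃ l : List Pt, IsPlaneCycle S l ∧ s(c, w) ∈ cycleEdgeSet l ∧ s(c, u) ∈ cycleEdgeSet l := by
  refine ⟨c :: L, ⟨?_, ?_, ?_, hN⟩, ?_, ?_⟩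
  · have hu' : u ∈ w :: l₁ := by rw [← hw, hu]; simp
    have hu' : u ∈ l₁ := (List.mem_cons.1 hu').resolve_left hwu.symm
    have := List.length_pos_of_mem hu'
    simp only [hw, List.length_cons]
    omega
  · refine List.nodup_cons.2 ⟨fun h => ((hmem c).1 h).1 rfl, hnd⟩
  · ext z
    simp only [List.mem_toFinset, List.mem_cons, hmem]
    by_cases hz : z = c <;> simp [*]
  · refine List.mem_toFinset.2 (List.mem_map.2 ⟨(c, w), ?_, rfl⟩)
    rw [cycleEdges_cons, hw]
    exact List.mem_cons_self
  · refine List.mem_toFinset.2 (List.mem_map.2 ⟨(u, c), ?_, Sym2.eq_swap⟩)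
    rw [cycleEdges_cons, hu]
    have := pathEdges_append_cons_cons (c :: l₂) [] u c
    simp only [List.cons_append, List.append_assoc, List.nil_append] at this ⊢
    rw [this]
    simp

lemma exists_radial_of_not_onHull {S : Finset Pt} (hS : GenPos S) {c h : Pt} (hc : c ∈ S)
    (hh : h ∈ S) (hhc : h ≠ c) (hno : ¬ OnHull S c) :
    ∃ L : List Pt, (∀ z, z ∈ h :: L ↔ z ≠ c ∧ z ∈ S) ∧
      (h :: L).Pairwise (fun x y => angFrom c h x < angFrom c h y) ∧
      (h :: L).IsChain (fun x y => angFrom c h x < angFrom c h y ∧ 0 < sign3 c x y) := by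
  obtain ⟨L, hmem, hs⟩ := exists_list_radial hS hc hhc (T := S.erase c) subset_rfl
  simp only [Finset.mem_erase] at hmem
  obtain ⟨L, rfl⟩ := exists_eq_cons_of_sorted hs ((hmem h).2 ⟨hhc, hh⟩) fun z _ => by
    rw [angFrom_self hhc]
    exact angFrom_nonneg _ _ _
  exact ⟨L, hmem, hs, (isChain_or_onHull hS hc hhc (fun z hz => ((hmem z).1 hz).symm)
    (fun z hz hzc _ => (hmem z).2 ⟨hzc, hz⟩) hs).resolve_right hno⟩

lemma viable_of_not_onHull_left {S : Finset Pt} (hS : GenPos S) {v p : Pt} (hv : v ∈ S)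
    (hp : p ∈ S) (hpv : p ≠ v) (h : ¬ OnHull S v) : Viable S v p := by
  obtain ⟨L, hmem, hs, hL⟩ := exists_radial_of_not_onHull hS hv hp hpv h
  refine ⟨L, List.nodup_cons.2 ⟨fun h => ((hmem v).1 h).1 rfl, nodup_of_sorted hs⟩, ?_,
    radial_path hpv (fun z hz => ((hmem z).1 hz).1) hL⟩
  ext z
  rw [List.mem_toFinset, List.mem_cons, hmem]
  by_cases hz : z = v <;> simp [*]

/-- The spanning cycle visiting all points in radial order around an interior point. -/
lemma exists_planeCycle_of_not_onHull {S : Finset Pt} (hS : GenPos S) {v q r : Pt} (hv : v ∈ S)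
    (hq : q ∈ S) (hr : r ∈ S) (hqv : q ≠ v) (hrv : r ≠ v) (hqr : q ≠ r) (hno : ¬ OnHull S v)
    (hcons : ∀ x ∈ S, x ≠ v → x ≠ q → x ≠ r → angFrom v q r < angFrom v q x) :
    ∃ l : List Pt, IsPlaneCycle S l ∧ s(v, q) ∈ cycleEdgeSet l ∧ s(v, r) ∈ cycleEdgeSet l := by
  obtain ⟨L, hmem, hs, hL⟩ := exists_radial_of_not_onHull hS hv hr hrv hno
  have hq0 : 0 < angFrom v q r := by
    refine lt_of_le_of_ne (angFrom_nonneg _ _ _) ?_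
    rw [← angFrom_self hqv]
    exact angFrom_ne hS hv hq hr hqv hqv hrv hqr
  have hqr' := angFrom_comm hqv hrv hq0
  obtain ⟨L', hL'⟩ := exists_eq_concat_of_sorted hs ((hmem q).2 ⟨hqv, hq⟩) fun z hz => by
    obtain ⟨hzv, hzS⟩ := (hmem z).1 hz
    by_cases hzq : z = q
    · rw [hzq]
    by_cases hzr : z = r
    · rw [hzr, angFrom_self hrv]
      exact angFrom_nonneg _ _ _
    · rw [hqr', angFrom_change_of_le hqv hrv hzv (hcons z hzS hzv hzq hzr).le]
      linarith [angFrom_lt v q z]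
  obtain ⟨L'', rfl⟩ : ∃ L'', L = L'' ++ [q] := by
    cases L' with
    | nil => simp at hL'; exact absurd hL'.1.symm hqr
    | cons a L' => exact ⟨L', by simpa using (List.cons.inj hL').2⟩
  obtain ⟨l, hl, h₁, h₂⟩ := exists_planeCycle_of_list hv rfl hL' hqr.symm (nodup_of_sorted hs) hmem
    (radial_cycle hrv (fun z hz => ((hmem z).1 hz).1) hs hL)
  exact ⟨l, hl, h₂, h₁⟩

/-- The spanning cycle visiting all points in radial order around a hull vertex. -/
lemma exists_planeCycle_of_supports {S : Finset Pt} (hS : GenPos S) {v a b : Pt} (hv : v ∈ S)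
    (ha : a ∈ S) (hb : b ∈ S) (hab : a ≠ b) (hva : Supports S v a) (hbv : Supports S b v) :
    ∃ l : List Pt, IsPlaneCycle S l ∧ s(v, a) ∈ cycleEdgeSet l ∧ s(v, b) ∈ cycleEdgeSet l := by
  have hav := hva.1.symm
  obtain ⟨L, hmem, hs⟩ := exists_list_radial hS hv hav (T := S.erase v) subset_rfl
  simp only [Finset.mem_erase] at hmem
  obtain ⟨L, rfl⟩ := exists_eq_cons_of_sorted hs ((hmem a).2 ⟨hav, ha⟩) fun z _ => by
    rw [angFrom_self hav]
    exact angFrom_nonneg _ _ _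
  obtain ⟨L', hL'⟩ := exists_eq_concat_of_sorted hs ((hmem b).2 ⟨hbv.1, hb⟩) fun z hz => by
    obtain ⟨hzv, hzS⟩ := (hmem z).1 hz
    by_cases hzb : z = b
    · rw [hzb]
    · refine ((hva.sign3_pos_iff_lt hzS hb hzv hbv.1).1 ?_).le
      rw [sign3_rotate]
      exact hbv.2 z hzS hzb hzv
  obtain ⟨L'', rfl⟩ : ∃ L'', L = L'' ++ [b] := by
    cases L' with
    | nil => simp at hL'; exact absurd hL'.1 hab
    | cons a L' => exact ⟨L', by simpa using (List.cons.inj hL').2⟩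
  refine exists_planeCycle_of_list hv rfl hL' hab (nodup_of_sorted hs) hmem
    (radial_cycle hav (fun z hz => ((hmem z).1 hz).1) hs (List.Pairwise.isChain ?_))
  refine hs.imp_of_mem fun {x y} hx hy hxy => ⟨hxy, ?_⟩
  exact (hva.sign3_pos_iff_lt ((hmem x).1 hx).2 ((hmem y).1 hy).2 ((hmem x).1 hx).1
    ((hmem y).1 hy).1).2 hxy

lemma Supports.angFrom_lt_angFrom {S : Finset Pt} {v a u z : Pt} (hva : Supports S v a)
    (h : Supports S u v) (hu : u ∈ S) (hz : z ∈ S) (hzv : z ≠ v) (hzu : z ≠ u) :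
    angFrom v a z < angFrom v a u := by
  refine (hva.sign3_pos_iff_lt hz hu hzv h.1).1 ?_
  rw [sign3_rotate]
  exact h.2 z hz hzu hzv

/-- Radially consecutive hull vertices span a hull edge. -/
lemma supports_of_forall_not_between {S : Finset Pt} (hS : GenPos S) {v a u w : Pt} (hv : v ∈ S)
    (hva : Supports S v a) (hu : u ∈ S) (hw : w ∈ S) (huv : u ≠ v) (hwv : w ≠ v)
    (hue : OnHull S u) (hwe : OnHull S w) (hlt : angFrom v a u < angFrom v a w)
    (hbetween : ∀ z ∈ S, z ≠ v → OnHull S z → angFrom v a u < angFrom v a z →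
      angFrom v a w ≤ angFrom v a z) : Supports S u w := by
  obtain ⟨t, ht, hut⟩ := hue.exists_next hS hu hv huv.symm
  have hwu : w ≠ u := by rintro rfl; exact lt_irrefl _ hlt
  have htv : t ≠ v := by
    rintro rfl
    exact lt_asymm hlt (hva.angFrom_lt_angFrom hut hu hw hwv hwu)
  have hlt' : angFrom v a u < angFrom v a t := by
    refine (hva.sign3_pos_iff_lt hu ht huv htv).1 ?_
    rw [← sign3_rotate]
    exact hut.2 v hv huv.symm htv.symm
  by_cases htw : t = w
  · exact htw ▸ hut
  exfalso
  have hwt : angFrom v a w < angFrom v a t := lt_of_le_of_ne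
    (hbetween t ht htv (hut.onHull_right hS ht) hlt')
    (angFrom_ne hS hv hw ht hva.1.symm hwv htv (Ne.symm htw))
  have h₁ : 0 < sign3 u t w := hut.2 w hw hwu (Ne.symm htw)
  have h₂ : 0 < sign3 v u w := (hva.sign3_pos_iff_lt hu hw huv hwv).2 hlt
  have h₃ : 0 < sign3 v w t := (hva.sign3_pos_iff_lt hw ht hwv htv).2 hwt
  obtain ⟨w', hww'⟩ := hwe
  have hnn : ∀ z ∈ S, z ≠ w → 0 ≤ sign3 w w' z := by
    intro z hz hzw
    by_cases hzw' : z = w'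
    · simp [hzw']
    · exact (hww'.2 z hz hzw hzw').le
  have key : sign3 u t w * sign3 w w' v + sign3 v w t * sign3 w w' u
      + sign3 v u w * sign3 w w' t = 0 := by
    unfold sign3; ring
  have k₁ := mul_nonneg h₁.le (hnn v hv hwv.symm)
  have k₂ := mul_nonneg h₃.le (hnn u hu hwu.symm)
  have k₃ := mul_nonneg h₂.le (hnn t ht htw)
  by_cases hvw' : v = w'
  · have := mul_pos h₃ (hww'.2 u hu hwu.symm (hvw' ▸ huv))
    linarith
  · have := mul_pos h₁ (hww'.2 v hv hwv.symm hvw')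
    linarith

lemma nonCrossing_of_isChain_supports {T : Finset Pt} {y : Pt} {N l : List Pt}
    (hN : (N ++ [y]).IsChain (Supports T)) (hnd : (N ++ y :: l).Nodup)
    (hT : ∀ z ∈ N ++ y :: l, z ∈ T) (hl : NonCrossing (pathEdges (y :: l))) :
    NonCrossing (pathEdges (N ++ y :: l)) := by
  induction N with
  | nil => exact hl
  | cons w N ih =>
    have ih := ih hN.tail hnd.of_cons fun z hz => hT z (List.mem_cons_of_mem _ hz)
    obtain ⟨w', N', h₁, h₂⟩ : ∃ w' N', N ++ y :: l = w' :: N' ∧ Supports T w w' := by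
      cases N with
      | nil => exact ⟨y, l, rfl, (List.isChain_cons_cons.1 hN).1⟩
      | cons w' N => exact ⟨w', N ++ y :: l, rfl, (List.isChain_cons_cons.1 hN).1⟩
    rw [List.cons_append, h₁] at hnd hT ⊢
    rw [h₁] at ih
    refine nonCrossing_append (T := T) (l₁ := []) (hT w (by simp)) (hT w' (by simp)) (by simp)
      (fun z hz => ⟨hT z (by simp [hz]), ?_, ?_⟩) h₂.unc (by simp [NonCrossing, pathEdges]) ih
      (by simp [pathEdges])
    · rintro rfl; simp [hz] at hnd
    · rintro rfl; simp [hz] at hnd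

/-- A plane path starting with `vq` through all points radially before `q`, ending on the hull. -/
lemma exists_path_before {S : Finset Pt} (hS : GenPos S) {v a q : Pt} (hv : v ∈ S) (ha : a ∈ S)
    (hva : Supports S v a) (hq : q ∈ S) (hqv : q ≠ v) (hqa : OnHull S q → q = a) :
    ∃ (x : Pt) (l t : List Pt), OnHull S x ∧
      (∀ z ∈ S, z ≠ v → OnHull S z → angFrom v a z ≤ angFrom v a q →
        angFrom v a z ≤ angFrom v a x) ∧
      (l ++ [x]).Nodup ∧ (∀ z, z ∈ l ++ [x] ↔ z ∈ S ∧ z ≠ v ∧ angFrom v a z ≤ angFrom v a q) ∧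
      NonCrossing (pathEdges (v :: (l ++ [x]))) ∧ l ++ [x] = q :: t := by
  have hav := hva.1.symm
  have haθ := angFrom_self hav
  set A := S.filter fun z => z ≠ v ∧ angFrom v a z ≤ angFrom v a q with hA
  have hAmem : ∀ z, z ∈ A ↔ z ∈ S ∧ z ≠ v ∧ angFrom v a z ≤ angFrom v a q := by simp [hA]
  have hqA : q ∈ A := (hAmem q).2 ⟨hq, hqv, le_rfl⟩
  have hAS : A ⊆ S := Finset.filter_subset _ _
  have hae : OnHull S a := hva.onHull_right hS ha
  obtain ⟨x, hx, hmax⟩ := (A.filter (OnHull S)).exists_max_image (angFrom v a)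
    ⟨a, by simp [hAmem, ha, hav, hae, haθ, angFrom_nonneg]⟩
  simp only [Finset.mem_filter, hAmem] at hx hmax
  obtain ⟨⟨hxS, hxv, hxq⟩, hxe⟩ := hx
  have hlast : ∀ z ∈ S, z ≠ v → OnHull S z → angFrom v a z ≤ angFrom v a q →
      angFrom v a z ≤ angFrom v a x := fun z h1 h2 h3 h4 => hmax z ⟨⟨h1, h2, h4⟩, h3⟩
  have hqpos : ∀ z ∈ A, z ≠ q → 0 < sign3 q v z := by
    intro z hz hzq
    obtain ⟨hzS, hzv, hzle⟩ := (hAmem z).1 hz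
    rw [← sign3_rotate, hva.sign3_pos_iff_lt hzS hq hzv hqv]
    exact lt_of_le_of_ne hzle (angFrom_ne hS hv hzS hq hav hzv hqv hzq)
  by_cases hxq' : x = q
  · refine ⟨x, [], [], hxe, hlast, by simp, fun z => ?_, by simp [NonCrossing, pathEdges],
      by simp [hxq']⟩
    rw [List.nil_append, List.mem_singleton]
    subst hxq'
    refine ⟨by rintro rfl; exact ⟨hq, hqv, le_rfl⟩, fun ⟨hzS, hzv, hz⟩ => ?_⟩
    by_contra hzx
    have hxa := hqa hxe
    refine angFrom_ne hS hv hzS hq hav hzv hqv hzx (le_antisymm hz ?_)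
    rw [hxa, haθ]
    exact angFrom_nonneg _ _ _
  · obtain ⟨l, hnd, hset, hN⟩ := exists_planePath_between (hS.mono hAS) hqA
      ((hAmem x).2 ⟨hxS, hxv, hxq⟩) (Ne.symm hxq')
      ⟨v, hqv, fun z hz hzq _ => hqpos z hz hzq⟩ (hxe.mono hAS)
    have hmem : ∀ z, z ∈ q :: (l ++ [x]) ↔ z ∈ A := fun z => by rw [← List.mem_toFinset, hset]
    refine ⟨x, q :: l, l ++ [x], hxe, hlast, hnd, fun z => (hmem z).trans (hAmem z), ?_, rfl⟩
    refine List.pairwise_cons.2 ⟨fun f hf => ?_, hN⟩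
    have hfm := mem_of_mem_pathEdges (l := q :: (l ++ [x])) hf
    rw [hmem, hmem] at hfm
    have hfne := fst_ne_snd_of_mem_pathEdges (l := q :: (l ++ [x])) hnd hf
    have hnn : ∀ z ∈ A, 0 ≤ sign3 q v z := by
      intro z hz
      by_cases hzq : z = q
      · simp [hzq]
      · exact (hqpos z hz hzq).le
    refine segDisj_of_nonpos_of_pos q v (by simp) (by simp) (hnn _ hfm.1) (hnn _ hfm.2) ?_
    by_cases h : f.1 = q
    · exact Or.inr (hqpos _ hfm.2 fun h' => hfne (h.trans h'.symm))
    · exact Or.inl (hqpos _ hfm.1 h)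

/-- A plane path ending with `rv` through all points radially after `r`, starting on the hull. -/
lemma exists_path_after {S : Finset Pt} (hS : GenPos S) {v a b r : Pt} (hv : v ∈ S)
    (hva : Supports S v a) (hb : b ∈ S) (hbv : Supports S b v) (hr : r ∈ S) (hrv : r ≠ v)
    (hrb : OnHull S r → Supports S r v) :
    ∃ (y : Pt) (l t : List Pt), OnHull S y ∧
      (∀ z ∈ S, z ≠ v → OnHull S z → angFrom v a r ≤ angFrom v a z →
        angFrom v a y ≤ angFrom v a z) ∧
      (y :: l).Nodup ∧ (∀ z, z ∈ y :: l ↔ z ∈ S ∧ z ≠ v ∧ angFrom v a r ≤ angFrom v a z) ∧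
      NonCrossing (pathEdges (y :: (l ++ [v]))) ∧ y :: l = t ++ [r] := by
  have hav := hva.1.symm
  set B := S.filter fun z => z ≠ v ∧ angFrom v a r ≤ angFrom v a z with hB
  have hBmem : ∀ z, z ∈ B ↔ z ∈ S ∧ z ≠ v ∧ angFrom v a r ≤ angFrom v a z := by simp [hB]
  have hrB : r ∈ B := (hBmem r).2 ⟨hr, hrv, le_rfl⟩
  have hBS : B ⊆ S := Finset.filter_subset _ _
  have hrb' : angFrom v a r ≤ angFrom v a b := by
    by_cases h : r = b
    · rw [h]
    · exact (hva.angFrom_lt_angFrom hbv hb hr hrv h).le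
  obtain ⟨y, hy, hmin⟩ := (B.filter (OnHull S)).exists_min_image (angFrom v a)
    ⟨b, Finset.mem_filter.2 ⟨(hBmem b).2 ⟨hb, hbv.1, hrb'⟩, ⟨v, hbv⟩⟩⟩
  simp only [Finset.mem_filter, hBmem] at hy hmin
  obtain ⟨⟨hyS, hyv, hyr⟩, hye⟩ := hy
  have hfirst : ∀ z ∈ S, z ≠ v → OnHull S z → angFrom v a r ≤ angFrom v a z →
      angFrom v a y ≤ angFrom v a z := fun z h1 h2 h3 h4 => hmin z ⟨⟨h1, h2, h4⟩, h3⟩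
  have hrpos : ∀ z ∈ B, z ≠ r → 0 < sign3 v r z := by
    intro z hz hzr
    obtain ⟨hzS, hzv, hzle⟩ := (hBmem z).1 hz
    rw [hva.sign3_pos_iff_lt hr hzS hrv hzv]
    exact lt_of_le_of_ne hzle (angFrom_ne hS hv hr hzS hav hrv hzv hzr.symm)
  by_cases hyr' : y = r
  · refine ⟨y, [], [], hye, hfirst, by simp, fun z => ?_, by simp [NonCrossing, pathEdges],
      by simp [hyr']⟩
    rw [List.mem_singleton]
    subst hyr'
    refine ⟨by rintro rfl; exact ⟨hr, hrv, le_rfl⟩, fun ⟨hzS, hzv, hz⟩ => ?_⟩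
    by_contra hzy
    exact hz.not_gt (hva.angFrom_lt_angFrom (hrb hye) hr hzS hzv hzy)
  · have hre : OnHull B r := by
      refine ⟨(2 * r.1 - v.1, 2 * r.2 - v.2), ?_, fun z hz hzr _ => ?_⟩
      · intro h
        refine hrv (Prod.ext ?_ ?_)
        · have := congrArg Prod.fst h; simp only at this; linarith
        · have := congrArg Prod.snd h; simp only at this; linarith
      · have := hrpos z hz hzr
        have h : sign3 r (2 * r.1 - v.1, 2 * r.2 - v.2) z = sign3 v r z := by
          simp only [sign3]; ring
        rwa [h]
    obtain ⟨l, hnd, hset, hN⟩ := exists_planePath_between (hS.mono hBS)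
      ((hBmem y).2 ⟨hyS, hyv, hyr⟩) hrB hyr' (hye.mono hBS) hre
    have hmem : ∀ z, z ∈ y :: (l ++ [r]) ↔ z ∈ B := fun z => by rw [← List.mem_toFinset, hset]
    refine ⟨y, l ++ [r], y :: l, hye, hfirst, hnd, fun z => (hmem z).trans (hBmem z), ?_, rfl⟩
    have heq : pathEdges (y :: (l ++ [r] ++ [v])) = pathEdges (y :: (l ++ [r])) ++ [(r, v)] := by
      simpa [pathEdges] using pathEdges_append_cons_cons (y :: l) [] r v
    rw [heq]
    refine List.pairwise_append.2 ⟨hN, by simp, fun f hf e he => ?_⟩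
    rw [List.mem_singleton.1 he]
    have hfm := mem_of_mem_pathEdges (l := y :: (l ++ [r])) hf
    rw [hmem, hmem] at hfm
    have hfne := fst_ne_snd_of_mem_pathEdges (l := y :: (l ++ [r])) hnd hf
    have hnn : ∀ z ∈ B, 0 ≤ sign3 v r z := by
      intro z hz
      by_cases hzr : z = r
      · simp [hzr]
      · exact (hrpos z hz hzr).le
    refine (segDisj_of_nonpos_of_pos v r (by simp) (by simp) (hnn _ hfm.1) (hnn _ hfm.2) ?_).symm
    by_cases h : f.1 = r
    · exact Or.inr (hrpos _ hfm.2 fun h' => hfne (h.trans h'.symm))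
    · exact Or.inl (hrpos _ hfm.1 h)

/-- The hull vertices radially between two hull vertices form a chain of hull edges. -/
lemma exists_hull_chain {S : Finset Pt} (hS : GenPos S) {v a x y : Pt} (hv : v ∈ S)
    (hva : Supports S v a) (hx : x ∈ S) (hy : y ∈ S) (hxv : x ≠ v) (hyv : y ≠ v)
    (hxe : OnHull S x) (hye : OnHull S y) (hxy : angFrom v a x < angFrom v a y) :
    ∃ N : List Pt, N.Nodup ∧
      (∀ z, z ∈ N ↔ z ∈ S ∧ z ≠ v ∧ OnHull S z ∧
        angFrom v a x < angFrom v a z ∧ angFrom v a z < angFrom v a y) ∧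
      (x :: (N ++ [y])).IsChain (Supports S) := by
  have hav := hva.1.symm
  obtain ⟨N, hN, hs⟩ := exists_list_radial hS hv hav
    (T := (S.erase v).filter fun z => OnHull S z ∧
      angFrom v a x < angFrom v a z ∧ angFrom v a z < angFrom v a y) (Finset.filter_subset _ _)
  have hN : ∀ z, z ∈ N ↔ z ∈ S ∧ z ≠ v ∧ OnHull S z ∧
        angFrom v a x < angFrom v a z ∧ angFrom v a z < angFrom v a y := fun z => by
    rw [hN, Finset.mem_filter, Finset.mem_erase]; tauto
  refine ⟨N, nodup_of_sorted hs, hN, ?_⟩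
  have hs' : (x :: (N ++ [y])).Pairwise (fun x y => angFrom v a x < angFrom v a y) := by
    simp only [List.pairwise_cons, List.pairwise_append, List.mem_append, List.mem_singleton]
    refine ⟨?_, hs, by simp, ?_⟩
    · rintro z (hz | rfl)
      · exact ((hN z).1 hz).2.2.2.1
      · exact hxy
    · rintro z hz _ rfl
      exact ((hN z).1 hz).2.2.2.2
  have hmem : ∀ z ∈ x :: (N ++ [y]), z ∈ S ∧ z ≠ v ∧ OnHull S z := by
    intro z hz
    simp only [List.mem_cons, List.mem_append, List.not_mem_nil, or_false] at hz
    rcases hz with rfl | hz | rfl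
    · exact ⟨hx, hxv, hxe⟩
    · exact ⟨((hN z).1 hz).1, ((hN z).1 hz).2.1, ((hN z).1 hz).2.2.1⟩
    · exact ⟨hy, hyv, hye⟩
  by_contra hcon
  obtain ⟨l₁, u, w, l₂, hl, hnot⟩ := exists_split_of_not_isChain hcon
  have hbound : ∀ z ∈ x :: (N ++ [y]),
      angFrom v a x ≤ angFrom v a z ∧ angFrom v a z ≤ angFrom v a y := by
    intro z hz
    simp only [List.mem_cons, List.mem_append, List.not_mem_nil, or_false] at hz
    rcases hz with rfl | hz | rfl
    · exact ⟨le_rfl, hxy.le⟩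
    · exact ⟨((hN z).1 hz).2.2.2.1.le, ((hN z).1 hz).2.2.2.2.le⟩
    · exact ⟨hxy.le, le_rfl⟩
  have hu' : u ∈ x :: (N ++ [y]) := by rw [hl]; simp
  have hw' : w ∈ x :: (N ++ [y]) := by rw [hl]; simp
  obtain ⟨hu, huv, hue⟩ := hmem u hu'
  obtain ⟨hw, hwv, hwe⟩ := hmem w hw'
  rw [hl] at hs'
  have hlt := (sorted_split_trichotomy hs' (z := u) (by simp)).1
  refine hnot (supports_of_forall_not_between hS hv hva hu hw huv hwv hue hwe hlt
    fun z hz hzv hze huz => ?_)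
  by_contra! hzw
  have hz' : z ∈ l₁ ++ u :: w :: l₂ := by
    rw [← hl]
    refine List.mem_cons_of_mem _ (List.mem_append_left _ ((hN z).2 ⟨hz, hzv, hze, ?_, ?_⟩))
    · exact (hbound u hu').1.trans_lt huz
    · exact hzw.trans_le (hbound w hw').2
  rcases (sorted_split_trichotomy hs' hz').2 with rfl | rfl | h | h
  · exact lt_irrefl _ huz
  · exact lt_irrefl _ hzw
  · exact lt_asymm h huz
  · exact lt_asymm h hzw

/-- If only hull vertices lie radially between `q` and `r`, then the paths through the points
before `q` and after `r` are joined along the hull to a spanning cycle. -/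
lemma exists_planeCycle_of_between {S : Finset Pt} (hS : GenPos S) {v a b q r : Pt} (hv : v ∈ S)
    (ha : a ∈ S) (hva : Supports S v a) (hb : b ∈ S) (hbv : Supports S b v) (hq : q ∈ S)
    (hqv : q ≠ v) (hqa : OnHull S q → q = a) (hr : r ∈ S) (hrv : r ≠ v)
    (hrb : OnHull S r → Supports S r v) (hqr : angFrom v a q < angFrom v a r)
    (hM : ∀ z ∈ S, z ≠ v → angFrom v a q < angFrom v a z → angFrom v a z < angFrom v a r →
      OnHull S z) :
    ∃ l : List Pt, IsPlaneCycle S l ∧ s(v, q) ∈ cycleEdgeSet l ∧ s(v, r) ∈ cycleEdgeSet l := by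
  obtain ⟨x, lA, tA, hxe, hxmax, hndA, hmA, hNA, hqt⟩ := exists_path_before hS hv ha hva hq hqv hqa
  obtain ⟨y, lB, tB, hye, hymin, hndB, hmB, hNB, hrt⟩ :=
    exists_path_after hS hv hva hb hbv hr hrv hrb
  obtain ⟨hx, hxv, hxq⟩ := (hmA x).1 (by simp)
  obtain ⟨hy, hyv, hyr⟩ := (hmB y).1 (by simp)
  obtain ⟨N, hndN, hmN, hchain⟩ :=
    exists_hull_chain hS hv hva hx hy hxv hyv hxe hye (by linarith)
  have hmN : ∀ z, z ∈ N ↔ z ∈ S ∧ z ≠ v ∧ angFrom v a q < angFrom v a z ∧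
      angFrom v a z < angFrom v a r := by
    intro z
    rw [hmN]
    constructor
    · rintro ⟨h1, h2, h3, h4, h5⟩
      refine ⟨h1, h2, ?_, ?_⟩
      · by_contra! h; exact (hxmax z h1 h2 h3 h).not_gt h4
      · by_contra! h; exact (hymin z h1 h2 h3 h).not_gt h5
    · rintro ⟨h1, h2, h3, h4⟩
      exact ⟨h1, h2, hM z h1 h2 h3 h4, by linarith, by linarith⟩
  -- the second half of the cycle, up to the return to `v`
  have hmW : ∀ z, z ∈ N ++ y :: lB ↔ z ∈ S ∧ z ≠ v ∧ angFrom v a q < angFrom v a z := by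
    intro z
    rw [List.mem_append, hmN, hmB]
    constructor
    · rintro (⟨h1, h2, h3, -⟩ | ⟨h1, h2, h3⟩)
      · exact ⟨h1, h2, h3⟩
      · exact ⟨h1, h2, by linarith⟩
    · rintro ⟨h1, h2, h3⟩
      rcases lt_or_ge (angFrom v a z) (angFrom v a r) with h | h
      · exact Or.inl ⟨h1, h2, h3, h⟩
      · exact Or.inr ⟨h1, h2, h⟩
  have hndW : (N ++ y :: lB).Nodup := by
    refine List.nodup_append'.2 ⟨hndN, hndB, fun z hz hz' => ?_⟩
    exact ((hmN z).1 hz).2.2.2.not_ge ((hmB z).1 hz').2.2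
  have hndW' : (N ++ y :: (lB ++ [v])).Nodup := by
    have : (N ++ y :: lB ++ [v]).Nodup := by
      refine List.nodup_append'.2 ⟨hndW, by simp, fun z hz hz' => ?_⟩
      exact ((hmW z).1 hz).2.1 (List.mem_singleton.1 hz')
    simpa using this
  have hmW' : ∀ z, z ∈ N ++ y :: (lB ++ [v]) ↔ z ∈ N ++ y :: lB ∨ z = v := by
    intro z
    simp only [List.mem_append, List.mem_cons, List.not_mem_nil, or_false]
    tauto
  have hNW : NonCrossing (pathEdges (N ++ y :: (lB ++ [v]))) := by
    refine nonCrossing_of_isChain_supports (T := S) hchain.tail hndW' (fun z hz => ?_) hNB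
    rcases (hmW' z).1 hz with h | rfl
    · exact ((hmW z).1 h).1
    · exact hv
  obtain ⟨w, W, hW, hxw, hwW⟩ : ∃ w W, N ++ y :: (lB ++ [v]) = w :: W ∧ Supports S x w ∧
      w ∈ N ++ y :: lB := by
    cases N with
    | nil => exact ⟨y, lB ++ [v], rfl, (List.isChain_cons_cons.1 hchain).1, by simp⟩
    | cons w N => exact ⟨w, N ++ y :: (lB ++ [v]), rfl,
        (List.isChain_cons_cons.1 hchain).1, by simp⟩
  have hAW : ∀ z ∈ lA ++ [x], z ∉ N ++ y :: lB := fun z hz hz' =>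
    ((hmA z).1 hz).2.2.not_gt ((hmW z).1 hz').2.2
  have hwv : w ≠ v := ((hmW w).1 hwW).2.1
  have hNC : NonCrossing (cycleEdges (v :: (lA ++ [x] ++ (N ++ y :: lB)))) := by
    have heq : v :: (lA ++ [x] ++ (N ++ y :: lB) ++ [v]) = (v :: lA) ++ x :: w :: W := by
      rw [← hW]; simp
    rw [cycleEdges_cons, heq]
    refine nonCrossing_append (T := S) hx ((hmW w).1 hwW).1 (fun z hz => ?_) (fun z hz => ?_)
      hxw.unc hNA (hW ▸ hNW) fun e he f hf => ?_
    · rcases List.mem_cons.1 hz with rfl | hz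
      · exact ⟨hv, hxv.symm, hwv.symm⟩
      · have hz' : z ∈ lA ++ [x] := List.mem_append_left _ hz
        refine ⟨((hmA z).1 hz').1, ?_, ?_⟩
        · rintro rfl
          simp [List.nodup_append', hz] at hndA
        · rintro rfl
          exact hAW z hz' hwW
    · have hz' : z ∈ N ++ y :: (lB ++ [v]) := by rw [hW]; exact List.mem_cons_of_mem _ hz
      have hzw : z ≠ w := by
        rintro rfl
        rw [hW] at hndW'
        exact (List.nodup_cons.1 hndW').1 hz
      rcases (hmW' z).1 hz' with h | rfl
      · refine ⟨((hmW z).1 h).1, ?_, hzw⟩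
        rintro rfl
        exact hAW z (by simp) h
      · exact ⟨hv, hxv.symm, hzw⟩
    · have hnp : ∀ z ∈ v :: (lA ++ [x]), sign3 v q z ≤ 0 := by
        intro z hz
        rcases List.mem_cons.1 hz with rfl | hz
        · simp
        · obtain ⟨h1, h2, h3⟩ := (hmA z).1 hz
          by_contra! hcon
          exact ((hva.sign3_pos_iff_lt hq h1 hqv h2).1 hcon).not_ge h3
      have hpos : ∀ z ∈ N ++ y :: lB, 0 < sign3 v q z := by
        intro z hz
        obtain ⟨h1, h2, h3⟩ := (hmW z).1 hz
        exact (hva.sign3_pos_iff_lt hq h1 hqv h2).2 h3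
      rw [← hW] at hf
      have hf₁ : 0 < sign3 v q f.1 := hpos _ <| by
        refine fst_mem_of_mem_pathEdges (x := v) ?_
        simpa using hf
      have hf₂ : 0 ≤ sign3 v q f.2 := by
        rcases (hmW' _).1 (mem_of_mem_pathEdges hf).2 with h | h
        · exact (hpos _ h).le
        · simp [h]
      have he := mem_of_mem_pathEdges (l := v :: (lA ++ [x])) he
      exact segDisj_of_nonpos_of_pos v q (hnp _ he.1) (hnp _ he.2) hf₁.le hf₂ (Or.inl hf₁)
  refine exists_planeCycle_of_list (l₁ := tA ++ (N ++ y :: lB)) (l₂ := lA ++ [x] ++ N ++ tB) hv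
    ?_ ?_ (by rintro rfl; exact lt_irrefl _ hqr) ?_ (fun z => ?_) hNC
  · rw [hqt]; simp
  · rw [hrt]; simp
  · exact List.nodup_append'.2 ⟨hndA, hndW, fun z hz hz' => hAW z hz hz'⟩
  · rw [List.mem_append, hmA, hmW]
    constructor
    · rintro (h | h) <;> exact ⟨h.2.1, h.1⟩
    · rintro ⟨h1, h2⟩
      rcases le_or_gt (angFrom v a z) (angFrom v a q) with h | h
      · exact Or.inl ⟨h2, h1, h⟩
      · exact Or.inr ⟨h2, h1, h⟩

/-- If `q, r` are consecutive in the radial order around `v₁` among the points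
forming viable starting edges with `v₁`, then there is a plane spanning cycle of
`S` containing both edges `v₁q` and `v₁r`. -/
theorem stmt_6 (S : Finset Pt) (hgp : GenPos S) (v1 : Pt) (hv1 : v1 ∈ S)
    (q r : Pt) (hq : q ∈ S) (hr : r ∈ S) (hqv : q ≠ v1) (hrv : r ≠ v1) (hqr : q ≠ r)
    (hqvia : Viable S v1 q) (hrvia : Viable S v1 r)
    (hconsec : ∀ x ∈ S, x ≠ v1 → Viable S v1 x → x ≠ q → x ≠ r →
      angFrom v1 q r < angFrom v1 q x) :
    ∃ l : List Pt, IsPlaneCycle S l ∧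
      s(v1, q) ∈ cycleEdgeSet l ∧ s(v1, r) ∈ cycleEdgeSet l := by
  by_cases hno : OnHull S v1
  swap
  · exact exists_planeCycle_of_not_onHull hgp hv1 hq hr hqv hrv hqr hno fun x hx hxv hxq hxr =>
      hconsec x hx hxv (viable_of_not_onHull_left hgp hv1 hx hxv hno) hxq hxr
  obtain ⟨a, ha, hva⟩ := hno.exists_next hgp hv1 hq hqv
  obtain ⟨b, hb, hbv⟩ := hno.exists_prev hgp hv1 hq hqv
  have hav := hva.1.symm
  have hqq := angFrom_self hqv
  have hr0 := angFrom_nonneg v1 q r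
  have hpi := Real.pi_pos
  rcases lt_or_gt_of_ne (angFrom_ne hgp hv1 hq hr hav hqv hrv hqr) with hlt | hlt
  · refine exists_planeCycle_of_between hgp hv1 ha hva hb hbv hq hqv (fun hqe => ?_) hr hrv
      (fun hre => ?_) hlt (fun z hz hzv hqz hzr => ?_)
    · by_contra hqa
      have h := hqvia.supports_of_onHull hgp hv1 hq ha hva hqe hqv hqa
      exact lt_asymm hlt (hva.angFrom_lt_angFrom h hq hr hrv hqr.symm)
    · refine hrvia.supports_of_onHull hgp hv1 hr ha hva hre hrv ?_
      rintro rfl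
      rw [angFrom_self hav] at hlt
      exact (angFrom_nonneg _ _ _).not_gt hlt
    · by_contra hze
      have h := hconsec z hz hzv (viable_of_not_onHull_right hgp hv1 hz hzv.symm hze)
        (by rintro rfl; exact lt_irrefl _ hqz) (by rintro rfl; exact lt_irrefl _ hzr)
      have h₁ := (hva.sign3_pos_iff_lt hq hr hqv hrv).2 hlt
      have h₂ := (hva.sign3_pos_iff_lt hz hr hzv hrv).2 hzr
      have h₃ := (hva.sign3_pos_iff_lt hq hz hqv hzv).2 hqz
      rw [sign3_pos_iff hqv hqv hzv, hqq] at h₃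
      rw [sign3_pos_iff hqv hzv hrv] at h₂
      rcases h₂ with h₂ | h₂ <;> rcases h₃ with h₃ | h₃ <;> linarith [angFrom_nonneg v1 q z]
  · have h₁ := (hva.sign3_pos_iff_lt hr hq hrv hqv).2 hlt
    rw [sign3_pos_iff hqv hrv hqv, hqq] at h₁
    have hrpi : Real.pi < angFrom v1 q r := by rcases h₁ with h₁ | h₁ <;> linarith
    have hra : r = a := by
      by_contra hra
      have haq : a ≠ q := by
        rintro rfl
        rw [angFrom_self hav] at hlt
        exact (angFrom_nonneg _ _ _).not_gt hlt
      have h := hconsec a ha hav (viable_of_supports hgp hv1 ha (Or.inl hva)) haq (Ne.symm hra)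
      have h₂ := hva.2 r hr hrv hra
      rw [sign3_pos_iff hqv hav hrv] at h₂
      rcases h₂ with h₂ | h₂ <;> linarith [angFrom_lt v1 q a]
    have hqb : q = b := by
      by_contra hqb
      have hbr : b ≠ r := by
        rintro rfl
        exact lt_asymm hlt (hva.angFrom_lt_angFrom hbv hb hq hqv hqb)
      have h := hconsec b hb hbv.1 (viable_of_supports hgp hv1 hb (Or.inr hbv)) (Ne.symm hqb) hbr
      have h₂ := (hva.sign3_pos_iff_lt hq hb hqv hbv.1).2
        (hva.angFrom_lt_angFrom hbv hb hq hqv hqb)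
      rw [sign3_pos_iff hqv hqv hbv.1, hqq] at h₂
      rcases h₂ with h₂ | h₂ <;> linarith [angFrom_nonneg v1 q b]
    subst hra hqb
    obtain ⟨l, hl, h₂, h₃⟩ := exists_planeCycle_of_supports hgp hv1 hr hq hqr.symm hva hbv
    exact ⟨l, hl, h₃, h₂⟩
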